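/- arXiv:2209.00368 — 5 statements merged into one kernel-verified Lean document; each statement's English description precedes it below -/
import Mathlib

section
/- Let ▷ be a linear order on a finite set C, p ∈ C, and I ⊆ C an interval of ▷ with |I| ≥ 2 and p ∉ I (so all of I lies on one side of p), and let c ∈ I. Write a for the endpoint of I farther from p and b for the endpoint of I closer to p. If (I \ {c}) ∪ {p} is also an interval of ▷, then c = a and no element of C lies strictly between b and p. -/
/-- A subset of a linearly ordered set is an interval if it contains every element lying
between two of its members. -/
def IsOrderInterval {α : Type*} [LinearOrder α] (I : Set α) : Prop :=
  ∀ a ∈ I, ∀ c ∈ I, ∀ b, a ≤ b → b ≤ c → b ∈ I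

/-- Let `I` be an interval of a finite linear order with `|I| ≥ 2` and `p ∉ I` (so all of
`I` lies on one side of `p`), and let `c ∈ I`. Write `a` for the endpoint of `I` farther
from `p` and `b` for the endpoint closer to `p`. If `(I \ {c}) ∪ {p}` is also an interval,
then `c = a` and no element lies strictly between `b` and `p`. -/
theorem swap_to_p_interval_structure {α : Type*} [LinearOrder α] [Fintype α] [DecidableEq α]
    (I : Finset α) (hne : I.Nonempty) (h2 : 2 ≤ I.card)
    (hint : IsOrderInterval (I : Set α)) (p : α) (hp : p ∉ I) (c : α) (hc : c ∈ I)
    (hswap : IsOrderInterval ((insert p (I.erase c) : Finset α) : Set α)) :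
    c = (if p < I.min' hne then I.max' hne else I.min' hne) ∧
      ∀ x : α,
        ¬ (min p (if p < I.min' hne then I.min' hne else I.max' hne) < x ∧
            x < max p (if p < I.min' hne then I.min' hne else I.max' hne)) := by
  have hmin := I.min'_mem hne
  have hmax := I.max'_mem hne
  have hlt : I.min' hne < I.max' hne := I.min'_lt_max'_of_card h2
  have hcmin := I.min'_le c hc
  have hcmax := I.le_max' c hc
  have hcp : c ≠ p := fun h => hp (h ▸ hc)
  have mem_iff : ∀ y, y ∈ ((insert p (I.erase c) : Finset α) : Set α) ↔
      y = p ∨ y ≠ c ∧ y ∈ I := by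
    simp [and_comm]
  have hp_mem := (mem_iff p).2 (Or.inl rfl)
  have hc_not_mem : c ∉ ((insert p (I.erase c) : Finset α) : Set α) := by
    simp [hcp]
  by_cases hpI : p < I.min' hne
  · simp only [if_pos hpI, min_eq_left hpI.le, max_eq_right hpI.le]
    have hc_eq : c = I.max' hne := by
      by_contra h
      exact hc_not_mem (hswap p hp_mem _ ((mem_iff _).2 (Or.inr ⟨Ne.symm h, hmax⟩)) c
        (hpI.le.trans hcmin) hcmax)
    refine ⟨hc_eq, fun x ⟨hpx, hxb⟩ => ?_⟩
    have hb := (mem_iff _).2 (Or.inr ⟨hc_eq ▸ hlt.ne, hmin⟩)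
    rcases (mem_iff x).1 (hswap p hp_mem _ hb x hpx.le hxb.le) with h | h
    · exact hpx.ne' h
    · exact hxb.not_ge (I.min'_le x h.2)
  · have hIp : I.max' hne < p := by
      by_contra h
      exact hp (hint _ hmin _ hmax p (not_lt.1 hpI) (not_lt.1 h))
    simp only [if_neg hpI, min_eq_right hIp.le, max_eq_left hIp.le]
    have hc_eq : c = I.min' hne := by
      by_contra h
      exact hc_not_mem (hswap _ ((mem_iff _).2 (Or.inr ⟨Ne.symm h, hmin⟩)) p hp_mem c
        hcmin (hcmax.trans hIp.le))
    refine ⟨hc_eq, fun x ⟨hbx, hxp⟩ => ?_⟩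
    have hb := (mem_iff _).2 (Or.inr ⟨hc_eq ▸ hlt.ne', hmax⟩)
    rcases (mem_iff x).1 (hswap _ hb p hp_mem x hbx.le hxp.le) with h | h
    · exact hxp.ne h
    · exact hbx.not_ge (I.le_max' x h.2)
end

section
/- Let (C,V) be an approval election with voters v_1,…,v_n that is VI with respect to the order v_1,…,v_n, let k be a committee size with 1 ≤ k ≤ |C|, let p ∈ C be approved exactly by the voters v_i,…,v_j (with i ≤ j), let B ∈ ℕ be a budget, and for every voter v and candidate c ∉ ballot(v) let π(v,c) ∈ ℕ be the price of adding c to v's ballot. Let s be the least nonnegative integer such that |{c ∈ C, c ≠ p : score(c) > score(p) + s}| ≤ k − 1. Then there exists an addition bribery of total price at most B — i.e., new ballots ballot'(v) ⊇ ballot(v) whose total added price is at most B, such that the new election is still VI with respect to v_1,…,v_n and p belongs to some AV winning committee of size k — if and only if there exist integers s_ℓ, s_r ≥ 0 with s_ℓ + s_r = s, i − s_ℓ ≥ 1, j + s_r ≤ n, and Σ_{a=i−s_ℓ}^{i−1} π(v_a, p) + Σ_{a=j+1}^{j+s_r} π(v_a, p) ≤ B. -/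
/-- The approval score of candidate `c` when the voters are `v_1, …, v_n`. -/
def avScore {α : Type*} [DecidableEq α] (n : ℕ) (ballot : ℕ → Finset α) (c : α) : ℕ :=
  ((Finset.Icc 1 n).filter fun v => c ∈ ballot v).card

/-- The election with voters `v_1, …, v_n` is VI (voter interval) with respect to this order:
for every candidate, the voters approving him or her form an interval of the order. -/
def VoterInterval {α : Type*} (n : ℕ) (C : Finset α) (ballot : ℕ → Finset α) : Prop :=
  ∀ c ∈ C, ∀ u ∈ Finset.Icc 1 n, ∀ w ∈ Finset.Icc 1 n, ∀ v ∈ Finset.Icc 1 n,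
    u ≤ v → v ≤ w → c ∈ ballot u → c ∈ ballot w → c ∈ ballot v

/-- Candidate `p` belongs to some AV winning committee of size `k`. -/
def InWinningCommittee {α : Type*} [DecidableEq α] (n : ℕ) (C : Finset α)
    (ballot : ℕ → Finset α) (k : ℕ) (p : α) : Prop :=
  ∃ W ⊆ C, W.card = k ∧ p ∈ W ∧
    ∀ W' ⊆ C, W'.card = k → ∑ c ∈ W', avScore n ballot c ≤ ∑ c ∈ W, avScore n ballot c

theorem inWinningCommittee_iff {α : Type*} [DecidableEq α] {n : ℕ} {C : Finset α}
    {ballot : ℕ → Finset α} {k : ℕ} {p : α} (hk1 : 1 ≤ k) (hk2 : k ≤ C.card) (hp : p ∈ C) :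
    InWinningCommittee n C ballot k p ↔
      (C.filter fun c => c ≠ p ∧ avScore n ballot p < avScore n ballot c).card ≤ k - 1 := by
  constructor
  · rintro ⟨W, hWC, hWk, hpW, hmax⟩
    by_contra! hcard
    obtain ⟨h, hH, hW⟩ : ∃ h ∈ C.filter fun c => c ≠ p ∧ avScore n ballot p < avScore n ballot c,
        h ∉ W.erase p := by
      apply Finset.exists_mem_notMem_of_card_lt_card
      rw [Finset.card_erase_of_mem hpW, hWk]
      exact hcard
    rw [Finset.mem_filter] at hH
    have hle := hmax (insert h (W.erase p))
      (Finset.insert_subset hH.1 ((Finset.erase_subset _ _).trans hWC))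
      (by rw [Finset.card_insert_of_notMem hW, Finset.card_erase_of_mem hpW, hWk]; omega)
    rw [Finset.sum_insert hW, ← Finset.add_sum_erase _ _ hpW] at hle
    omega
  · intro hcard
    obtain ⟨W, hW, hmax⟩ := Finset.exists_max_image (C.powersetCard k)
      (fun W => ∑ c ∈ W, avScore n ballot c) (Finset.powersetCard_nonempty.2 hk2)
    rw [Finset.mem_powersetCard] at hW
    have hmax' : ∀ W' ⊆ C, W'.card = k →
        ∑ c ∈ W', avScore n ballot c ≤ ∑ c ∈ W, avScore n ballot c :=
      fun W' h₁ h₂ => hmax W' (Finset.mem_powersetCard.2 ⟨h₁, h₂⟩)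
    by_cases hpW : p ∈ W
    · exact ⟨W, hW.1, hW.2, hpW, hmax'⟩
    obtain ⟨w, hwW, hwH⟩ : ∃ w ∈ W,
        w ∉ C.filter fun c => c ≠ p ∧ avScore n ballot p < avScore n ballot c := by
      apply Finset.exists_mem_notMem_of_card_lt_card
      omega
    have hwp : w ≠ p := fun h => hpW (h ▸ hwW)
    have hle : avScore n ballot w ≤ avScore n ballot p := by
      by_contra! hlt
      exact hwH (Finset.mem_filter.2 ⟨hW.1 hwW, hwp, hlt⟩)
    have hpe : p ∉ W.erase w := fun h => hpW (Finset.mem_of_mem_erase h)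
    refine ⟨insert p (W.erase w), Finset.insert_subset hp ((Finset.erase_subset _ _).trans hW.1),
      ?_, Finset.mem_insert_self _ _, fun W' h₁ h₂ => (hmax' W' h₁ h₂).trans ?_⟩
    · rw [Finset.card_insert_of_notMem hpe, Finset.card_erase_of_mem hwW, hW.2]; omega
    · rw [Finset.sum_insert hpe, ← Finset.add_sum_erase _ _ hwW]
      omega

theorem avScore_eq_of_interval {α : Type*} [DecidableEq α] {n : ℕ} {ballot : ℕ → Finset α}
    {c : α} {i j : ℕ} (h1i : 1 ≤ i) (hjn : j ≤ n)
    (h : ∀ v ∈ Finset.Icc 1 n, (c ∈ ballot v ↔ i ≤ v ∧ v ≤ j)) :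
    avScore n ballot c = j + 1 - i := by
  rw [avScore, ← Nat.card_Icc]
  congr 1
  ext v
  simp only [Finset.mem_filter, Finset.mem_Icc]
  refine ⟨fun hv => (h v (Finset.mem_Icc.2 hv.1)).1 hv.2, fun hv => ?_⟩
  have hv' : 1 ≤ v ∧ v ≤ n := by omega
  exact ⟨hv', (h v (Finset.mem_Icc.2 hv')).2 hv⟩

theorem avScore_mono {α : Type*} [DecidableEq α] {n : ℕ} {ballot ballot' : ℕ → Finset α}
    (h : ∀ v ∈ Finset.Icc 1 n, ballot v ⊆ ballot' v) (c : α) :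
    avScore n ballot c ≤ avScore n ballot' c := by
  apply Finset.card_le_card
  intro v hv
  rw [Finset.mem_filter] at hv ⊢
  exact ⟨hv.1, h v hv.1 hv.2⟩

/-- A set of numbers below `i` that is closed upwards below `i` ends with any number of
consecutive elements not exceeding its size. -/
theorem Ico_sub_subset_of_le_card {L : Finset ℕ} {i m : ℕ} (hlt : ∀ v ∈ L, 1 ≤ v ∧ v < i)
    (hup : ∀ u ∈ L, ∀ v, u ≤ v → v < i → v ∈ L) (hm : m ≤ L.card) :
    Finset.Ico (i - m) i ⊆ L := by
  intro v hv
  rw [Finset.mem_Ico] at hv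
  by_contra hvL
  have hsub : L ⊆ Finset.Ico (v + 1) i := fun u hu => by
    have := hlt u hu
    rw [Finset.mem_Ico]
    refine ⟨?_, this.2⟩
    by_contra! hle
    exact hvL (hup u hu v (by omega) hv.2)
  have := Finset.card_le_card hsub
  rw [Nat.card_Ico] at this
  omega

/-- A set of numbers above `j` that is closed downwards above `j` starts with any number of
consecutive elements not exceeding its size. -/
theorem Ioc_add_subset_of_le_card {R : Finset ℕ} {j m : ℕ} (hlt : ∀ v ∈ R, j < v)
    (hdown : ∀ w ∈ R, ∀ v, j < v → v ≤ w → v ∈ R) (hm : m ≤ R.card) :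
    Finset.Ioc j (j + m) ⊆ R := by
  intro v hv
  rw [Finset.mem_Ioc] at hv
  by_contra hvR
  have hsub : R ⊆ Finset.Ioo j v := fun w hw => by
    rw [Finset.mem_Ioo]
    refine ⟨hlt w hw, ?_⟩
    by_contra! hle
    exact hvR (hdown w hw v hv.1 hle)
  have := Finset.card_le_card hsub
  rw [Nat.card_Ioo] at this
  omega

/-- Correctness of the algorithm for priced bribery by adding approvals in VI elections:
an addition bribery of total price at most `B` preserving the VI order and putting `p`
into some AV winning committee exists iff approvals for `p` can be added to `s_ℓ` voters
directly to the left and `s_r` voters directly to the right of `p`'s voter interval, with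
`s_ℓ + s_r = s` (the least score increase that suffices), within the budget. -/
theorem addApprovals_VI_bribery {α : Type*} [DecidableEq α]
    (C : Finset α) (n : ℕ) (hn : 1 ≤ n) (ballot : ℕ → Finset α)
    (hsub : ∀ v ∈ Finset.Icc 1 n, ballot v ⊆ C)
    (hVI : VoterInterval n C ballot)
    (k : ℕ) (hk1 : 1 ≤ k) (hk2 : k ≤ C.card)
    (p : α) (hp : p ∈ C)
    (i j : ℕ) (h1i : 1 ≤ i) (hij : i ≤ j) (hjn : j ≤ n)
    (hpinterval : ∀ v ∈ Finset.Icc 1 n, (p ∈ ballot v ↔ i ≤ v ∧ v ≤ j))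
    (B : ℕ) (π : ℕ → α → ℕ) (s : ℕ)
    (hs : (C.filter fun c => c ≠ p ∧ avScore n ballot p + s < avScore n ballot c).card ≤ k - 1)
    (hsleast : ∀ s' < s,
      ¬ (C.filter fun c => c ≠ p ∧ avScore n ballot p + s' < avScore n ballot c).card ≤ k - 1) :
    (∃ ballot' : ℕ → Finset α,
        (∀ v ∈ Finset.Icc 1 n, ballot v ⊆ ballot' v) ∧
        (∀ v ∈ Finset.Icc 1 n, ballot' v ⊆ C) ∧
        (∑ v ∈ Finset.Icc 1 n, ∑ c ∈ ballot' v \ ballot v, π v c) ≤ B ∧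
        VoterInterval n C ballot' ∧
        InWinningCommittee n C ballot' k p)
      ↔ ∃ sl sr : ℕ, sl + sr = s ∧ sl + 1 ≤ i ∧ j + sr ≤ n ∧
          (∑ a ∈ Finset.Ico (i - sl) i, π a p) + (∑ a ∈ Finset.Ioc j (j + sr), π a p) ≤ B := by
  simp_rw [inWinningCommittee_iff hk1 hk2 hp]
  constructor
  · rintro ⟨ballot', hadd, -, hcost, hVI', hwin⟩
    set X := (Finset.Icc 1 n).filter fun v => p ∈ ballot' v with hX
    have memX : ∀ {v}, v ∈ X ↔ (1 ≤ v ∧ v ≤ n) ∧ p ∈ ballot' v := by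
      intro v; rw [hX, Finset.mem_filter, Finset.mem_Icc]
    have hmid : ∀ v, i ≤ v → v ≤ j → v ∈ X := fun v h₁ h₂ => by
      have hv : v ∈ Finset.Icc 1 n := Finset.mem_Icc.2 ⟨h1i.trans h₁, h₂.trans hjn⟩
      exact Finset.mem_filter.2 ⟨hv, hadd v hv ((hpinterval v hv).2 ⟨h₁, h₂⟩)⟩
    have hconv : ∀ u ∈ X, ∀ w ∈ X, ∀ v, u ≤ v → v ≤ w → v ∈ X := fun u hu w hw v h₁ h₂ => by
      have hu' := memX.1 hu
      have hw' := memX.1 hw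
      have hv : 1 ≤ v ∧ v ≤ n := ⟨hu'.1.1.trans h₁, h₂.trans hw'.1.2⟩
      exact memX.2 ⟨hv, hVI' p hp u (Finset.mem_Icc.2 hu'.1) w (Finset.mem_Icc.2 hw'.1) v
        (Finset.mem_Icc.2 hv) h₁ h₂ hu'.2 hw'.2⟩
    set L := X.filter (· < i) with hL
    set R := X.filter (j < ·) with hR
    have hXcard : avScore n ballot' p = avScore n ballot p + (L.card + R.card) := by
      have hdisj : Disjoint L R := by
        rw [Finset.disjoint_left]
        intro v h₁ h₂
        rw [hL, Finset.mem_filter] at h₁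
        rw [hR, Finset.mem_filter] at h₂
        omega
      have hdisj' : Disjoint (Finset.Icc i j) (L ∪ R) := by
        rw [Finset.disjoint_left]
        intro v h₁ h₂
        simp only [hL, hR, Finset.mem_union, Finset.mem_filter] at h₂
        rw [Finset.mem_Icc] at h₁
        rcases h₂ with ⟨-, h⟩ | ⟨-, h⟩ <;> omega
      rw [avScore_eq_of_interval h1i hjn hpinterval, ← Nat.card_Icc,
        ← Finset.card_union_of_disjoint hdisj, ← Finset.card_union_of_disjoint hdisj']
      change X.card = _
      congr 1
      ext v
      simp only [hL, hR, Finset.mem_union, Finset.mem_filter, Finset.mem_Icc]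
      have := hmid v
      constructor
      · intro hv
        by_cases h₁ : v < i
        · exact Or.inr (Or.inl ⟨hv, h₁⟩)
        · by_cases h₂ : j < v
          · exact Or.inr (Or.inr ⟨hv, h₂⟩)
          · exact Or.inl (by omega)
      · rintro (h | h | h)
        · exact this h.1 h.2
        · exact h.1
        · exact h.1
    have hsle : s ≤ L.card + R.card := by
      by_contra! hlt
      refine hsleast _ hlt (le_trans (Finset.card_le_card ?_) hwin)
      intro c hc
      rw [Finset.mem_filter] at hc ⊢
      refine ⟨hc.1, hc.2.1, ?_⟩
      rw [hXcard]
      exact hc.2.2.trans_le (avScore_mono hadd c)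
    have hiX := hmid i le_rfl hij
    have hjX := hmid j hij le_rfl
    have hLbd : ∀ v ∈ L, 1 ≤ v ∧ v < i := fun v hv => by
      have hv' := Finset.mem_filter.1 hv
      exact ⟨(memX.1 hv'.1).1.1, hv'.2⟩
    have hRbd : ∀ v ∈ R, j < v ∧ v ≤ n := fun v hv => by
      have hv' := Finset.mem_filter.1 hv
      exact ⟨hv'.2, (memX.1 hv'.1).1.2⟩
    have hLcard : L.card ≤ i - 1 := by
      rw [← Nat.card_Ico]
      exact Finset.card_le_card fun v hv => Finset.mem_Ico.2 (hLbd v hv)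
    have hRcard : R.card ≤ n - j := by
      rw [← Nat.card_Ioc]
      exact Finset.card_le_card fun v hv => Finset.mem_Ioc.2 (hRbd v hv)
    refine ⟨min s L.card, s - min s L.card, by omega, by omega, by omega, le_trans ?_ hcost⟩
    have hIL : Finset.Ico (i - min s L.card) i ⊆ L := by
      refine Ico_sub_subset_of_le_card hLbd (fun u hu v h₁ h₂ => ?_) (min_le_right _ _)
      exact Finset.mem_filter.2 ⟨hconv u (Finset.mem_filter.1 hu).1 i hiX v h₁ h₂.le, h₂⟩
    have hIR : Finset.Ioc j (j + (s - min s L.card)) ⊆ R := by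
      refine Ioc_add_subset_of_le_card (fun v hv => (hRbd v hv).1) (fun w hw v h₁ h₂ => ?_)
        (by omega)
      exact Finset.mem_filter.2 ⟨hconv j hjX w (Finset.mem_filter.1 hw).1 v h₁.le h₂, h₁⟩
    have hdisj : Disjoint (Finset.Ico (i - min s L.card) i)
        (Finset.Ioc j (j + (s - min s L.card))) := by
      rw [Finset.disjoint_left]
      intro v h₁ h₂
      rw [Finset.mem_Ico] at h₁
      rw [Finset.mem_Ioc] at h₂
      omega
    rw [← Finset.sum_union hdisj]
    have hmem : ∀ v ∈ Finset.Ico (i - min s L.card) i ∪ Finset.Ioc j (j + (s - min s L.card)),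
        v ∈ Finset.Icc 1 n ∧ p ∈ ballot' v \ ballot v := by
      intro v hv
      obtain ⟨hvX, hout⟩ : v ∈ X ∧ (v < i ∨ j < v) := by
        rcases Finset.mem_union.1 hv with h | h
        · exact ⟨(Finset.mem_filter.1 (hIL h)).1, Or.inl (Finset.mem_filter.1 (hIL h)).2⟩
        · exact ⟨(Finset.mem_filter.1 (hIR h)).1, Or.inr (Finset.mem_filter.1 (hIR h)).2⟩
      obtain ⟨hv1, hv2⟩ := Finset.mem_filter.1 hvX
      refine ⟨hv1, Finset.mem_sdiff.2 ⟨hv2, fun hb => ?_⟩⟩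
      have := (hpinterval v hv1).1 hb
      omega
    calc _ ≤ ∑ v ∈ Finset.Ico (i - min s L.card) i ∪ Finset.Ioc j (j + (s - min s L.card)),
            ∑ c ∈ ballot' v \ ballot v, π v c :=
          Finset.sum_le_sum fun v hv =>
            Finset.single_le_sum (f := fun c => π v c) (fun _ _ => Nat.zero_le _) (hmem v hv).2
      _ ≤ _ := Finset.sum_le_sum_of_subset fun v hv => (hmem v hv).1
  · rintro ⟨sl, sr, hss, hsl, hsr, hcost⟩
    set A := Finset.Ico (i - sl) i ∪ Finset.Ioc j (j + sr) with hA
    have memA : ∀ {v}, v ∈ A ↔ (i - sl ≤ v ∧ v < i) ∨ (j < v ∧ v ≤ j + sr) := by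
      intro v; rw [hA, Finset.mem_union, Finset.mem_Ico, Finset.mem_Ioc]
    have hdisj : Disjoint (Finset.Ico (i - sl) i) (Finset.Ioc j (j + sr)) := by
      rw [Finset.disjoint_left]
      intro v h₁ h₂
      rw [Finset.mem_Ico] at h₁
      rw [Finset.mem_Ioc] at h₂
      omega
    have hAsub : A ⊆ Finset.Icc 1 n := fun v hv => by
      have := memA.1 hv
      rw [Finset.mem_Icc]
      omega
    set ballot' : ℕ → Finset α := fun v => if v ∈ A then insert p (ballot v) else ballot v
      with hb'
    have hne : ∀ c ≠ p, ∀ v, c ∈ ballot' v ↔ c ∈ ballot v := by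
      intro c hc v
      simp only [hb']
      split_ifs <;> simp [hc]
    have hpi' : ∀ v ∈ Finset.Icc 1 n, (p ∈ ballot' v ↔ i - sl ≤ v ∧ v ≤ j + sr) := by
      intro v hv
      have h₁ := hpinterval v hv
      have h₂ : p ∈ ballot' v ↔ v ∈ A ∨ p ∈ ballot v := by
        simp only [hb']
        split_ifs with h <;> simp [h]
      rw [h₂, h₁, memA]
      omega
    refine ⟨ballot', fun v _ => ?_, fun v hv => ?_, ?_, ?_, ?_⟩
    · simp only [hb']
      split_ifs
      · exact Finset.subset_insert _ _
      · exact subset_rfl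
    · simp only [hb']
      split_ifs
      · exact Finset.insert_subset hp (hsub v hv)
      · exact hsub v hv
    · refine le_trans (le_of_eq ?_) hcost
      rw [← Finset.sum_union hdisj, ← hA, ← Finset.sum_subset hAsub]
      · refine Finset.sum_congr rfl fun v hv => ?_
        have hpv : p ∉ ballot v := fun h => by
          have := (hpinterval v (hAsub hv)).1 h
          have := memA.1 hv
          omega
        simp [hb', hv, Finset.insert_sdiff_of_notMem _ hpv]
      · intro v _ hv
        simp [hb', hv]
    · intro c hc u hu w hw v hv huv hvw hcu hcw
      by_cases hcp : c = p
      · subst hcp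
        rw [hpi' _ hu] at hcu
        rw [hpi' _ hw] at hcw
        rw [hpi' _ hv]
        omega
      · rw [hne c hcp] at hcu hcw ⊢
        exact hVI c hc u hu w hw v hv huv hvw hcu hcw
    · have hscore : avScore n ballot' p = avScore n ballot p + s := by
        rw [avScore_eq_of_interval h1i hjn hpinterval,
          avScore_eq_of_interval (by omega) hsr hpi']
        omega
      refine le_trans (Finset.card_le_card ?_) hs
      intro c hc
      rw [Finset.mem_filter] at hc ⊢
      refine ⟨hc.1, hc.2.1, ?_⟩
      rw [← hscore]
      have : avScore n ballot' c = avScore n ballot c := by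
        simp only [avScore, hne c hc.2.1]
      rw [← this]
      exact hc.2.2
end

section
/- For all i ∈ {1,…,m'}, e ≥ 0 and t ≥ 0, the function f satisfies the recurrence f(i,e,t) = min over e' ∈ {0,…,e} of ( cost(i,e') + f(i−1, e−e', t − χ(i,e)) ), where f(i−1, ·, −1) = +∞. -/
/-- `fDP Vs cost b s0 xr i e t` is the minimum, over all sets `W ⊆ V_1 ∪ … ∪ V_i` with
`|W| = e` such that at most `t` indices `a ∈ {1, …, i}` have `W`-score
`b a + |W ∩ (V_{a+1} ∪ … ∪ V_i)|` greater than `S(e) = s0 + e + xr`, of the total cost of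
`W` (and `+∞` if no such `W` exists). -/
noncomputable def fDP {ι : Type*} [DecidableEq ι] (Vs : ℕ → Finset ι) (cost : ι → ℕ)
    (b : ℕ → ℕ) (s0 xr : ℕ) (i e t : ℕ) : ℕ∞ :=
  sInf { z : ℕ∞ | ∃ W ⊆ (Finset.Icc 1 i).biUnion Vs, W.card = e ∧
    ((Finset.Icc 1 i).filter fun a =>
      s0 + e + xr < b a + (W ∩ (Finset.Icc (a + 1) i).biUnion Vs).card).card ≤ t ∧
    z = (∑ w ∈ W, cost w : ℕ) }

/-- `costDP Vs cost i e'` is the minimum total cost of a size-`e'` subset of `V_i`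
(`+∞` if `|V_i| < e'`). -/
noncomputable def costDP {ι : Type*} [DecidableEq ι] (Vs : ℕ → Finset ι) (cost : ι → ℕ)
    (i e' : ℕ) : ℕ∞ :=
  sInf { z : ℕ∞ | ∃ W ⊆ Vs i, W.card = e' ∧ z = (∑ w ∈ W, cost w : ℕ) }

theorem sInf_mem_of_ne_top {s : Set ℕ∞} (h : sInf s ≠ ⊤) : sInf s ∈ s :=
  csInf_mem <| Set.nonempty_iff_ne_empty.mpr fun hs => h (by rw [hs, sInf_empty])

/-- The `W`-scores split along the last block: adding `X ⊆ V_{n+1}` raises both the threshold and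
the score of every earlier index by `|X|`, so only the index `n + 1` can be newly exceeded. -/
theorem card_exceeding_union {ι : Type*} [DecidableEq ι] {Vs : ℕ → Finset ι} {n : ℕ}
    {U X : Finset ι} (hd : Disjoint ((Finset.Icc 1 n).biUnion Vs) (Vs (n + 1)))
    (hU : U ⊆ (Finset.Icc 1 n).biUnion Vs) (hX : X ⊆ Vs (n + 1)) (b : ℕ → ℕ) (s0 xr : ℕ) :
    ((Finset.Icc 1 (n + 1)).filter fun a => s0 + (U.card + X.card) + xr <
        b a + ((U ∪ X) ∩ (Finset.Icc (a + 1) (n + 1)).biUnion Vs).card).card =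
      ((Finset.Icc 1 n).filter fun a => s0 + U.card + xr <
        b a + (U ∩ (Finset.Icc (a + 1) n).biUnion Vs).card).card +
        if s0 + (U.card + X.card) + xr < b (n + 1) then 1 else 0 := by
  have hUX : Disjoint U X := hd.mono hU hX
  have hscore : ∀ a ∈ Finset.Icc 1 n,
      ((U ∪ X) ∩ (Finset.Icc (a + 1) (n + 1)).biUnion Vs).card =
        (U ∩ (Finset.Icc (a + 1) n).biUnion Vs).card + X.card := by
    intro a ha
    have ha' : a + 1 ≤ n + 1 := by simp at ha; omega
    rw [← Finset.card_union_of_disjoint (hUX.mono_left Finset.inter_subset_left)]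
    congr 1
    rw [← Finset.insert_Icc_right_eq_Icc_add_one ha', Finset.biUnion_insert]
    have hUV : Disjoint U (Vs (n + 1)) := hd.mono_left hU
    ext x
    have h1 : x ∈ U → x ∉ Vs (n + 1) := fun h => Finset.disjoint_left.mp hUV h
    have h2 := @hX x
    simp only [Finset.mem_inter, Finset.mem_union]
    tauto
  rw [← Finset.insert_Icc_right_eq_Icc_add_one (Nat.le_add_left 1 n), Finset.filter_insert]
  rw [Finset.filter_congr (q := fun a => s0 + U.card + xr <
    b a + (U ∩ (Finset.Icc (a + 1) n).biUnion Vs).card)]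
  · simp only [Finset.Icc_eq_empty_of_lt (Nat.lt_succ_self (n + 1)), Finset.biUnion_empty,
      Finset.inter_empty, Finset.card_empty, add_zero]
    split_ifs
    · rw [Finset.card_insert_of_notMem (by simp)]
    · rfl
  · intro a ha
    rw [hscore a ha]
    omega

/-- The recurrence of the dynamic program for priced bribery by adding approvals in
candidate-interval elections: for `i ∈ {1, …, m'}`,
`f(i,e,t) = min_{e' ∈ {0,…,e}} ( cost(i,e') + f(i−1, e−e', t − χ(i,e)) )`,
where `χ(i,e) = 1` if `b i > S(e)` and `0` otherwise, and `f(i−1, ·, −1) = +∞`. -/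
theorem fDP_recurrence {ι : Type*} [DecidableEq ι] (Vs : ℕ → Finset ι) (cost : ι → ℕ)
    (b : ℕ → ℕ) (s0 xr m' : ℕ) (hm : 1 ≤ m')
    (hdisj : ∀ i ∈ Finset.Icc 1 m', ∀ j ∈ Finset.Icc 1 m', i ≠ j → Disjoint (Vs i) (Vs j))
    (i : ℕ) (hi : i ∈ Finset.Icc 1 m') (e t : ℕ) :
    fDP Vs cost b s0 xr i e t =
      (Finset.Icc 0 e).inf fun e' =>
        costDP Vs cost i e' +
          (if s0 + e + xr < b i ∧ t = 0 then (⊤ : ℕ∞)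
           else fDP Vs cost b s0 xr (i - 1) (e - e')
                  (t - if s0 + e + xr < b i then 1 else 0)) := by
  obtain ⟨n, rfl⟩ : ∃ n, i = n + 1 := ⟨i - 1, by simp at hi; omega⟩
  have hd : Disjoint ((Finset.Icc 1 n).biUnion Vs) (Vs (n + 1)) := by
    rw [Finset.disjoint_biUnion_left]
    intro j hj
    simp only [Finset.mem_Icc] at hi hj
    exact hdisj j (by simp; omega) (n + 1) (by simp; omega) (by omega)
  rw [Nat.add_sub_cancel]
  apply le_antisymm
  · refine Finset.le_inf fun e' he' => ?_
    rw [Finset.mem_Icc] at he'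
    by_cases hχ : s0 + e + xr < b (n + 1) ∧ t = 0
    · simp [hχ]
    rw [if_neg hχ]
    by_cases hc : costDP Vs cost (n + 1) e' = ⊤
    · simp [hc]
    by_cases hf : fDP Vs cost b s0 xr n (e - e')
        (t - if s0 + e + xr < b (n + 1) then 1 else 0) = ⊤
    · simp [hf]
    obtain ⟨X, hX, hXc, hXz⟩ := sInf_mem_of_ne_top (show sInf _ ≠ ⊤ from hc)
    obtain ⟨U, hU, hUc, hUt, hUz⟩ := sInf_mem_of_ne_top (show sInf _ ≠ ⊤ from hf)
    have hcard : U.card + X.card = e := by omega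
    have key := card_exceeding_union hd hU hX b s0 xr
    rw [hcard] at key
    rw [← hUc] at hUt
    rw [costDP, hXz, fDP, fDP, hUz]
    refine sInf_le ⟨U ∪ X, ?_, ?_, ?_, ?_⟩
    · rw [← Finset.insert_Icc_right_eq_Icc_add_one (Nat.le_add_left 1 n), Finset.biUnion_insert,
        Finset.union_comm]
      exact Finset.union_subset_union hX hU
    · rw [Finset.card_union_of_disjoint (hd.mono hU hX), hcard]
    · rw [key]
      split_ifs at hUt ⊢ <;> omega
    · rw [Finset.sum_union (hd.mono hU hX), add_comm]
      push_cast
      rfl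
  · refine le_sInf ?_
    rintro z ⟨W, hW, hWc, hWt, rfl⟩
    obtain ⟨U, X, hU, hX, rfl⟩ : ∃ U X, U ⊆ (Finset.Icc 1 n).biUnion Vs ∧ X ⊆ Vs (n + 1) ∧
        W = U ∪ X := by
      refine ⟨W ∩ (Finset.Icc 1 n).biUnion Vs, W ∩ Vs (n + 1), Finset.inter_subset_right,
        Finset.inter_subset_right, ?_⟩
      rw [← Finset.insert_Icc_right_eq_Icc_add_one (Nat.le_add_left 1 n), Finset.biUnion_insert,
        Finset.union_comm] at hW
      rw [← Finset.inter_union_distrib_left, Finset.inter_eq_left.mpr hW]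
    have hUX := hd.mono hU hX
    rw [Finset.card_union_of_disjoint hUX] at hWc
    subst hWc
    rw [card_exceeding_union hd hU hX] at hWt
    refine (Finset.inf_le (b := X.card) (by simp)).trans ?_
    rw [if_neg (by rintro ⟨h, rfl⟩; simp [h] at hWt), Finset.sum_union hUX, add_comm, Nat.cast_add]
    refine add_le_add (sInf_le ⟨U, hU, by omega, ?_, rfl⟩) (sInf_le ⟨X, hX, rfl, rfl⟩)
    rw [Nat.add_sub_cancel]
    omega
end

section
/- For the election constructed from an RX3C instance (X, 𝒮) as described, there exists a deletion bribery of total cost at most 9n — i.e., a replacement of each voter's ballot by a subset of it, with finite total deletion price at most 9n, such that the resulting election is still CI with respect to the given societal axis and p belongs to some AV winning committee of size n+1 — if and only if (X, 𝒮) is a yes-instance of RX3C. -/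
/-- A finite set of natural numbers (axis positions) is an interval of the societal axis. -/
def IsAxisInterval (I : Finset ℕ) : Prop :=
  ∀ a ∈ I, ∀ b ∈ I, ∀ x : ℕ, a ≤ x → x ≤ b → x ∈ I

/-- Voters of the construction: `.inl (i, c)` (with `i < 2`) is the `i`-th fixed voter of
the candidate at axis position `c`; `.inr (j, a)` is the solution voter `v(s_j, x_a)`. -/
abbrev DelVoter : Type := (ℕ × ℕ) ⊕ (ℕ × ℕ)

/-- Axis positions: `s_j` at `j` (for `j ∈ [1, 3n]`), dummy `d_j` at `3n + j`
(for `j ∈ [1, 2n]`), `x_a` at `5n + a` (for `a ∈ [1, 3n]`), and `p` at `8n + 1`. -/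
def delBallot (n : ℕ) : DelVoter → Finset ℕ
  | .inl (_, c) => {c}
  | .inr (j, a) => Finset.Icc j (5 * n + a)

/-- Deletion prices: fixed approvals cost `+∞`; in a solution voter's ballot `[s_j, x_a]`,
deleting an endpoint approval (`s_j` or `x_a`) costs `1` and deleting an interior approval
costs `0`. -/
def delPrice (n : ℕ) : DelVoter → ℕ → ℕ∞
  | .inl _, _ => ⊤
  | .inr (j, a), c => if c = j ∨ c = 5 * n + a then 1 else 0

/-- The voter collection: two fixed voters for every set candidate, dummy candidate and `p`
(positions `[1, 5n] ∪ {8n+1}`), and a solution voter `v(s_j, x_a)` for every `j ∈ [1, 3n]`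
and every `x_a ∈ S_j`. -/
def delVoters (n : ℕ) (S : ℕ → Finset ℕ) : Finset DelVoter :=
  ((Finset.range 2 ×ˢ (Finset.Icc 1 (5 * n) ∪ {8 * n + 1}))).disjSum
    ((Finset.Icc 1 (3 * n)).biUnion fun j => (S j).image fun a => (j, a))

section

open Finset

/-- If `W` maximises `∑ f` among the subsets of `C` of its size, then fewer than `#W` elements of
`C` beat a given member `p` of `W`. -/
theorem card_filter_lt_of_max_sum {α : Type*} [DecidableEq α] {C W : Finset α} {f : α → ℕ} {p : α}
    (hWC : W ⊆ C) (hp : p ∈ W)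
    (hmax : ∀ W' ⊆ C, W'.card = W.card → ∑ c ∈ W', f c ≤ ∑ c ∈ W, f c) :
    (C.filter fun c => f p < f c).card < W.card := by
  by_contra! h
  have hlt : (W.erase p).card < (C.filter fun c => f p < f c).card :=
    (card_erase_lt_of_mem hp).trans_le h
  obtain ⟨c, hc, hcW⟩ := exists_mem_notMem_of_card_lt_card hlt
  obtain ⟨hcC, hfc⟩ := mem_filter.1 hc
  have hsub : insert c (W.erase p) ⊆ C :=
    insert_subset hcC ((erase_subset _ _).trans hWC)
  have hcard : (insert c (W.erase p)).card = W.card := by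
    rw [card_insert_of_notMem hcW, card_erase_add_one hp]
  have := hmax _ hsub hcard
  rw [sum_insert hcW, ← add_sum_erase W f hp] at this
  omega

/-- The solution voters, indexed by the pairs `(j, a)` with `x_a ∈ S_j`. -/
def solutionPairs (n : ℕ) (S : ℕ → Finset ℕ) : Finset (ℕ × ℕ) :=
  (Icc 1 (3 * n)).biUnion fun j => (S j).image fun a => (j, a)

theorem mem_solutionPairs {n : ℕ} {S : ℕ → Finset ℕ} {v : ℕ × ℕ} :
    v ∈ solutionPairs n S ↔ v.1 ∈ Icc 1 (3 * n) ∧ v.2 ∈ S v.1 := by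
  obtain ⟨j, a⟩ := v
  simp only [solutionPairs, mem_biUnion, mem_image, Prod.mk.injEq]
  constructor
  · rintro ⟨j', hj', a', ha', rfl, rfl⟩
    exact ⟨hj', ha'⟩
  · rintro ⟨hj, ha⟩
    exact ⟨j, hj, a, ha, rfl, rfl⟩

theorem inr_mem_delVoters {n : ℕ} {S : ℕ → Finset ℕ} {v : ℕ × ℕ} :
    (Sum.inr v : DelVoter) ∈ delVoters n S ↔ v ∈ solutionPairs n S := by
  rw [delVoters, inr_mem_disjSum, solutionPairs]

theorem card_solutionPairs {n : ℕ} {S : ℕ → Finset ℕ}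
    (hS : ∀ j ∈ Icc 1 (3 * n), (S j).card = 3) : (solutionPairs n S).card = 9 * n := by
  rw [solutionPairs, card_biUnion]
  · rw [sum_congr rfl fun j hj => by
      rw [card_image_of_injective _ (Prod.mk_right_injective j), hS j hj]]
    simp
    omega
  · intro i _ j _ hij
    rw [Function.onFun, disjoint_left]
    simp only [mem_image, not_exists, not_and]
    rintro _ ⟨a, _, rfl⟩ b _ h
    exact hij (congrArg Prod.fst h).symm

/-- If the fixed voters keep their approvals, then a candidate's score is its two fixed approvals
(for a set candidate, a dummy or `p`) plus its approvals from solution voters. -/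
theorem card_filter_delVoters {n : ℕ} {S : ℕ → Finset ℕ} {b : DelVoter → Finset ℕ}
    (hb : ∀ v : ℕ × ℕ, (Sum.inl v : DelVoter) ∈ delVoters n S → b (Sum.inl v) = {v.2}) (c : ℕ) :
    ((delVoters n S).filter fun v => c ∈ b v).card =
      (if c ∈ Icc 1 (5 * n) ∪ {8 * n + 1} then 2 else 0) +
        ((solutionPairs n S).filter fun v => c ∈ b (Sum.inr v)).card := by
  have hfix : ∑ v ∈ range 2 ×ˢ (Icc 1 (5 * n) ∪ {8 * n + 1}),
      (if c ∈ b (Sum.inl v) then 1 else 0) =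
      ∑ v ∈ range 2 ×ˢ (Icc 1 (5 * n) ∪ {8 * n + 1}), if c = v.2 then 1 else 0 := by
    refine sum_congr rfl fun v hv => ?_
    simp only [hb v (by rw [delVoters, inl_mem_disjSum]; exact hv), mem_singleton]
  simp only [card_filter, delVoters, solutionPairs, sum_disjSum]
  rw [hfix, sum_product]
  simp only [sum_ite_eq, sum_const, card_range, smul_eq_mul]
  split_ifs <;> rfl

/-- The ballots that keep only the left endpoint of the solution voters of sets in `T`, and only
the right endpoint of all the other solution voters. -/
def coverBallot (n : ℕ) (T : Finset ℕ) : DelVoter → Finset ℕ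
  | .inl (_, c) => {c}
  | .inr (j, a) => if j ∈ T then {j} else {5 * n + a}

theorem coverBallot_subset {n : ℕ} {S : ℕ → Finset ℕ} {T : Finset ℕ} {v : DelVoter}
    (hv : v ∈ delVoters n S) :
    coverBallot n T v ⊆ delBallot n v := by
  obtain ⟨i, c⟩ | ⟨j, a⟩ := v
  · rfl
  · rw [inr_mem_delVoters, mem_solutionPairs, mem_Icc] at hv
    have := hv.1
    simp only at this
    simp only [coverBallot, delBallot]
    split_ifs <;> simp <;> omega

theorem isAxisInterval_coverBallot (n : ℕ) (T : Finset ℕ) (v : DelVoter) :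
    IsAxisInterval (coverBallot n T v) := by
  have key : ∀ a : ℕ, IsAxisInterval {a} := by
    intro a x hx y hy z h1 h2
    simp only [mem_singleton] at *
    omega
  obtain ⟨i, c⟩ | ⟨j, a⟩ := v
  · exact key c
  · simp only [coverBallot]
    split_ifs
    · exact key j
    · exact key _

theorem price_coverBallot_le (n : ℕ) (T : Finset ℕ) (v : ℕ × ℕ) :
    ∑ c ∈ delBallot n (.inr v) \ coverBallot n T (.inr v), delPrice n (.inr v) c ≤ 1 := by
  obtain ⟨j, a⟩ := v
  have key : ∀ e : ℕ, (∀ c, c ∉ coverBallot n T (.inr (j, a)) → c = j ∨ c = 5 * n + a → c = e) →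
      ∑ c ∈ delBallot n (.inr (j, a)) \ coverBallot n T (.inr (j, a)),
        delPrice n (.inr (j, a)) c ≤ 1 := by
    intro e he
    calc _ ≤ ∑ c ∈ delBallot n (.inr (j, a)) \ coverBallot n T (.inr (j, a)),
            (if c = e then 1 else 0 : ℕ∞) := by
          refine sum_le_sum fun c hc => ?_
          have := he c (mem_sdiff.1 hc).2
          simp only [delPrice]
          split_ifs <;> simp_all
      _ ≤ 1 := by
          rw [sum_ite_eq']
          split_ifs <;> simp
  by_cases hj : j ∈ T
  · refine key (5 * n + a) fun c hc => ?_
    simp only [coverBallot, hj, if_true, mem_singleton] at hc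
    tauto
  · refine key j fun c hc => ?_
    simp only [coverBallot, hj, if_false, mem_singleton] at hc
    tauto

theorem sum_price_coverBallot_le {n : ℕ} {S : ℕ → Finset ℕ}
    (hS : ∀ j ∈ Icc 1 (3 * n), (S j).card = 3) (T : Finset ℕ) :
    ∑ v ∈ delVoters n S, ∑ c ∈ delBallot n v \ coverBallot n T v, delPrice n v c
      ≤ ((9 * n : ℕ) : ℕ∞) := by
  rw [delVoters, sum_disjSum]
  have h0 : ∀ v : ℕ × ℕ, ∑ c ∈ delBallot n (.inl v) \ coverBallot n T (.inl v),
      delPrice n (.inl v) c = 0 := by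
    intro v
    simp [delBallot, coverBallot]
  rw [sum_eq_zero fun v _ => h0 v, zero_add]
  refine (sum_le_sum fun v _ => price_coverBallot_le n T v).trans ?_
  rw [sum_const, ← solutionPairs, card_solutionPairs hS]
  simp

theorem mem_coverBallot_inr {n c : ℕ} {T : Finset ℕ} {v : ℕ × ℕ} :
    c ∈ coverBallot n T (.inr v) ↔ v.1 ∈ T ∧ c = v.1 ∨ v.1 ∉ T ∧ c = 5 * n + v.2 := by
  obtain ⟨j, a⟩ := v
  simp only [coverBallot]
  split_ifs with h <;> simp [h]

theorem score_coverBallot_le {n : ℕ} {S : ℕ → Finset ℕ} {T : Finset ℕ}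
    (hS : ∀ j ∈ Icc 1 (3 * n), S j ⊆ Icc 1 (3 * n) ∧ (S j).card = 3)
    (hocc : ∀ a ∈ Icc 1 (3 * n), ((Icc 1 (3 * n)).filter fun j => a ∈ S j).card = 3)
    (hT : T ⊆ Icc 1 (3 * n)) (hcov : ∀ a ∈ Icc 1 (3 * n), ∃ j ∈ T, a ∈ S j) (c : ℕ) :
    ((delVoters n S).filter fun v => c ∈ coverBallot n T v).card ≤ 2 + if c ∈ T then 3 else 0 := by
  rw [card_filter_delVoters fun v _ => rfl]
  by_cases hc : c ∈ T
  · have hcn := hT hc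
    have hsub : ((solutionPairs n S).filter fun v => c ∈ coverBallot n T (.inr v)) ⊆
        (S c).image fun a => (c, a) := by
      rintro ⟨j, a⟩ hv
      simp only [mem_filter, mem_coverBallot_inr, mem_solutionPairs, mem_Icc] at hv
      rw [mem_Icc] at hcn
      obtain rfl : c = j := by omega
      exact mem_image_of_mem _ hv.1.2
    have h3 := (card_le_card hsub).trans card_image_le
    rw [(hS c hcn).2] at h3
    rw [if_pos hc]
    split_ifs <;> omega
  · rw [if_neg hc]
    have hpos : ∀ v ∈ (solutionPairs n S).filter fun v => c ∈ coverBallot n T (.inr v),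
        v.1 ∈ Icc 1 (3 * n) ∧ v.2 ∈ Icc 1 (3 * n) ∧ v.2 ∈ S v.1 ∧ v.1 ∉ T ∧ c = 5 * n + v.2 := by
      intro v hv
      rw [mem_filter, mem_coverBallot_inr, mem_solutionPairs] at hv
      obtain ⟨⟨h1, h2⟩, ⟨h3, rfl⟩ | h3⟩ := hv
      · exact absurd h3 hc
      · exact ⟨h1, (hS _ h1).1 h2, h2, h3⟩
    obtain he | ⟨⟨j, a⟩, hv⟩ :=
      ((solutionPairs n S).filter fun v => c ∈ coverBallot n T (.inr v)).eq_empty_or_nonempty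
    · rw [he, card_empty]
      split_ifs <;> omega
    · obtain ⟨-, ha, -, -, hca⟩ := hpos _ hv
      simp only at ha hca
      obtain ⟨i, hiT, hai⟩ := hcov a ha
      have hsub : ((solutionPairs n S).filter fun v => c ∈ coverBallot n T (.inr v)) ⊆
          (((Icc 1 (3 * n)).filter fun j => a ∈ S j).erase i).image fun j => (j, a) := by
        rintro ⟨j', a'⟩ hv'
        obtain ⟨h1, -, h3, h4, h5⟩ := hpos _ hv'
        simp only at h1 h3 h4 h5
        obtain rfl : a' = a := by omega
        refine mem_image_of_mem _ (mem_erase.2 ⟨?_, mem_filter.2 ⟨h1, h3⟩⟩)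
        rintro rfl
        exact h4 hiT
      have h2 := (card_le_card hsub).trans card_image_le
      rw [card_erase_of_mem (mem_filter.2 ⟨hT hiT, hai⟩), hocc a ha] at h2
      have hcF : c ∉ Icc 1 (5 * n) ∪ {8 * n + 1} := by
        simp only [mem_union, mem_Icc, mem_singleton] at ha ⊢
        omega
      rw [if_neg hcF]
      omega

theorem le_score_coverBallot {n c : ℕ} {S : ℕ → Finset ℕ} {T : Finset ℕ}
    (hS : ∀ j ∈ Icc 1 (3 * n), (S j).card = 3) (hT : T ⊆ Icc 1 (3 * n))
    (hc : c ∈ insert (8 * n + 1) T) :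
    (2 + if c ∈ T then 3 else 0) ≤
      ((delVoters n S).filter fun v => c ∈ coverBallot n T v).card := by
  have hcF : c ∈ Icc 1 (5 * n) ∪ {8 * n + 1} := by
    rw [mem_insert] at hc
    rw [mem_union, mem_singleton, mem_Icc]
    rcases hc with hc | hc
    · exact Or.inr hc
    · have := mem_Icc.1 (hT hc)
      omega
  rw [card_filter_delVoters fun v _ => rfl, if_pos hcF]
  refine Nat.add_le_add_left ?_ 2
  split_ifs with hcT
  · rw [← hS c (hT hcT), ← card_image_of_injective (S c) (Prod.mk_right_injective c)]
    refine card_le_card fun v hv => ?_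
    obtain ⟨a, ha, rfl⟩ := mem_image.1 hv
    exact mem_filter.2 ⟨mem_solutionPairs.2 ⟨hT hcT, ha⟩, mem_coverBallot_inr.2 (.inl ⟨hcT, rfl⟩)⟩
  · exact Nat.zero_le _

/-- A solution voter that loses an endpoint contributes at least `1` to the price, and at least `2`
if both endpoints are lost. -/
theorem le_price_solution {n : ℕ} {v : ℕ × ℕ} {I : Finset ℕ} (hv : v.1 < 5 * n + v.2)
    (hI : v.1 ∉ I ∨ 5 * n + v.2 ∉ I) :
    (1 + if v.1 ∉ I ∧ 5 * n + v.2 ∉ I then 1 else 0 : ℕ∞) ≤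
      ∑ c ∈ delBallot n (.inr v) \ I, delPrice n (.inr v) c := by
  obtain ⟨j, a⟩ := v
  simp only at hv hI ⊢
  have hj : j ∈ delBallot n (.inr (j, a)) := mem_Icc.2 ⟨le_rfl, hv.le⟩
  have ha : 5 * n + a ∈ delBallot n (.inr (j, a)) := mem_Icc.2 ⟨hv.le, le_rfl⟩
  split_ifs with h
  · have hsub : {j, 5 * n + a} ⊆ delBallot n (.inr (j, a)) \ I := by
      intro c hc
      rw [mem_insert, mem_singleton] at hc
      obtain rfl | rfl := hc
      · exact mem_sdiff.2 ⟨hj, h.1⟩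
      · exact mem_sdiff.2 ⟨ha, h.2⟩
    refine le_trans (le_of_eq ?_) (sum_le_sum_of_subset hsub)
    rw [sum_pair hv.ne]
    simp [delPrice]
  · rw [add_zero]
    obtain h | h := hI
    · refine le_trans (le_of_eq ?_) (single_le_sum (fun _ _ => zero_le) (mem_sdiff.2 ⟨hj, h⟩))
      simp [delPrice]
    · refine le_trans (le_of_eq ?_) (single_le_sum (fun _ _ => zero_le) (mem_sdiff.2 ⟨ha, h⟩))
      simp [delPrice]

/-- If the sets with a pair satisfying `P`, together with the elements none of whose pairs satisfies
`P`, number at most `n`, then these sets form an exact cover. -/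
theorem exists_cover_of_card_le {n : ℕ} {S : ℕ → Finset ℕ} {P : ℕ × ℕ → Prop} {T U : Finset ℕ}
    (hS : ∀ j ∈ Icc 1 (3 * n), (S j).card = 3)
    (hT : ∀ j, j ∈ T ↔ j ∈ Icc 1 (3 * n) ∧ ∃ a ∈ S j, P (j, a))
    (hU : ∀ a, a ∈ U ↔ a ∈ Icc 1 (3 * n) ∧ ∀ j ∈ Icc 1 (3 * n), a ∈ S j → ¬ P (j, a))
    (hcard : T.card + U.card ≤ n) :
    T ⊆ Icc 1 (3 * n) ∧ T.card = n ∧ ∀ a ∈ Icc 1 (3 * n), ∃ j ∈ T, a ∈ S j := by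
  have hTs : T ⊆ Icc 1 (3 * n) := fun j hj => ((hT j).1 hj).1
  have hUs : U ⊆ Icc 1 (3 * n) := fun a ha => ((hU a).1 ha).1
  have hsub : Icc 1 (3 * n) \ U ⊆ T.biUnion S := by
    intro a ha
    rw [mem_sdiff, hU] at ha
    obtain ⟨ha, h⟩ := ha
    push Not at h
    obtain ⟨j, hj, haj, hP⟩ := h ha
    exact mem_biUnion.2 ⟨j, (hT j).2 ⟨hj, a, haj, hP⟩, haj⟩
  have hle := (card_le_card hsub).trans
    (card_biUnion_le_card_mul T S 3 fun j hj => (hS j (hTs hj)).le)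
  rw [card_sdiff_of_subset hUs, Nat.card_Icc] at hle
  have hU0 : U = ∅ := card_eq_zero.1 (by omega)
  subst hU0
  rw [card_empty] at hle hcard
  refine ⟨hTs, by omega, fun a ha => ?_⟩
  rw [sdiff_empty] at hsub
  exact mem_biUnion.1 (hsub ha)

/-- The ballots of the fixed voters survive any deletion bribery of finite price. -/
theorem fixed_ballot_eq {n B : ℕ} {S : ℕ → Finset ℕ} {b : DelVoter → Finset ℕ}
    (hsub : ∀ v ∈ delVoters n S, b v ⊆ delBallot n v)
    (hprice : (∑ v ∈ delVoters n S, ∑ c ∈ delBallot n v \ b v, delPrice n v c) ≤ (B : ℕ∞))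
    (v : ℕ × ℕ) (hv : (Sum.inl v : DelVoter) ∈ delVoters n S) : b (.inl v) = {v.2} := by
  refine (hsub _ hv).antisymm fun c hc => ?_
  by_contra hcb
  have h1 : delPrice n (.inl v) c ≤ ∑ c ∈ delBallot n (.inl v) \ b (.inl v),
      delPrice n (.inl v) c :=
    single_le_sum (fun _ _ => zero_le) (mem_sdiff.2 ⟨hc, hcb⟩)
  have h2 := h1.trans (single_le_sum (f := fun v => ∑ c ∈ delBallot n v \ b v, delPrice n v c)
    (fun _ _ => zero_le) hv)
  exact ENat.natCast_ne_top B (top_le_iff.1 (h2.trans hprice))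

/-- Within budget `9n`, if every solution voter loses an endpoint, then none loses both. -/
theorem endpoint_mem_of_price_le {n : ℕ} {S : ℕ → Finset ℕ} {b : DelVoter → Finset ℕ}
    (hS : ∀ j ∈ Icc 1 (3 * n), (S j).card = 3)
    (hlt : ∀ v ∈ solutionPairs n S, v.1 < 5 * n + v.2)
    (hprice : (∑ v ∈ delVoters n S, ∑ c ∈ delBallot n v \ b v, delPrice n v c)
      ≤ ((9 * n : ℕ) : ℕ∞))
    (hlose : ∀ v ∈ solutionPairs n S, v.1 ∉ b (.inr v) ∨ 5 * n + v.2 ∉ b (.inr v))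
    (v : ℕ × ℕ) (hv : v ∈ solutionPairs n S) : v.1 ∈ b (.inr v) ∨ 5 * n + v.2 ∈ b (.inr v) := by
  by_contra! h
  rw [delVoters, sum_disjSum] at hprice
  have h1 := (sum_le_sum fun v hv => le_price_solution (hlt v hv) (hlose v hv)).trans
    (le_add_self.trans hprice)
  rw [sum_add_distrib, sum_const, card_solutionPairs hS, nsmul_eq_mul, mul_one] at h1
  have h2 := single_le_sum
    (f := fun v : ℕ × ℕ => (if v.1 ∉ b (.inr v) ∧ 5 * n + v.2 ∉ b (.inr v) then 1 else 0 : ℕ∞))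
    (fun _ _ => zero_le) hv
  simp only [if_pos h] at h2
  have h3 : ((9 * n + 1 : ℕ) : ℕ∞) ≤ ((9 * n : ℕ) : ℕ∞) := by
    refine le_trans ?_ h1
    push_cast
    gcongr
  rw [Nat.cast_le] at h3
  omega

end

/-- NP-hardness construction for `AV-$DelApprovals-CI-Bribery`: for the election built from
an RX3C instance `(X, 𝒮)`, a CI-preserving deletion bribery of total price at most `9n`
putting `p` into some AV winning committee of size `n + 1` exists iff `(X, 𝒮)` is a
yes-instance of RX3C. -/
theorem delApprovals_CI_hardness (n : ℕ) (hn : 1 ≤ n) (S : ℕ → Finset ℕ)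
    (hS : ∀ j ∈ Finset.Icc 1 (3 * n), S j ⊆ Finset.Icc 1 (3 * n) ∧ (S j).card = 3)
    (hocc : ∀ a ∈ Finset.Icc 1 (3 * n),
      ((Finset.Icc 1 (3 * n)).filter fun j => a ∈ S j).card = 3) :
    (∃ ballot' : DelVoter → Finset ℕ,
        (∀ v ∈ delVoters n S, ballot' v ⊆ delBallot n v) ∧
        (∀ v ∈ delVoters n S, IsAxisInterval (ballot' v)) ∧
        (∑ v ∈ delVoters n S, ∑ c ∈ delBallot n v \ ballot' v, delPrice n v c)
          ≤ ((9 * n : ℕ) : ℕ∞) ∧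
        (∃ W ⊆ Finset.Icc 1 (8 * n + 1), W.card = n + 1 ∧ 8 * n + 1 ∈ W ∧
          ∀ W' ⊆ Finset.Icc 1 (8 * n + 1), W'.card = n + 1 →
            ∑ c ∈ W', ((delVoters n S).filter fun v => c ∈ ballot' v).card ≤
              ∑ c ∈ W, ((delVoters n S).filter fun v => c ∈ ballot' v).card))
      ↔ ∃ T ⊆ Finset.Icc 1 (3 * n), T.card = n ∧
          ∀ a ∈ Finset.Icc 1 (3 * n), ∃ j ∈ T, a ∈ S j := by
  have hS3 : ∀ j ∈ Finset.Icc 1 (3 * n), (S j).card = 3 := fun j hj => (hS j hj).2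
  have hmem : ∀ v ∈ solutionPairs n S,
      (1 ≤ v.1 ∧ v.1 ≤ 3 * n) ∧ 1 ≤ v.2 ∧ v.2 ≤ 3 * n := by
    intro v hv
    obtain ⟨h1, h2⟩ := mem_solutionPairs.1 hv
    exact ⟨Finset.mem_Icc.1 h1, Finset.mem_Icc.1 ((hS _ h1).1 h2)⟩
  constructor
  · rintro ⟨b, hsub, hint, hprice, W, hWC, hWcard, hpW, hmax⟩
    have hfix := fixed_ballot_eq hsub hprice
    have hscore := card_filter_delVoters hfix
    have hp : ((delVoters n S).filter fun v => 8 * n + 1 ∈ b v).card = 2 := by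
      rw [hscore, if_pos (by simp), Finset.filter_eq_empty_iff.2, Finset.card_empty]
      intro v hv hpv
      have h1 := Finset.mem_Icc.1 (hsub _ (inr_mem_delVoters.2 hv) hpv)
      have := hmem v hv
      omega
    have hfew := card_filter_lt_of_max_sum
      (f := fun c => ((delVoters n S).filter fun v => c ∈ b v).card) hWC hpW
      fun W' hW' h => hmax W' hW' (h.trans hWcard)
    simp only [hp, hWcard] at hfew
    have hbeat : ∀ c ∈ Finset.Icc 1 (5 * n), ∀ v ∈ solutionPairs n S, c ∈ b (.inr v) →
        2 < ((delVoters n S).filter fun v => c ∈ b v).card := by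
      intro c hc v hv hcv
      rw [hscore, if_pos (Finset.mem_union_left _ hc)]
      have : 0 < ((solutionPairs n S).filter fun v => c ∈ b (.inr v)).card :=
        Finset.card_pos.2 ⟨v, Finset.mem_filter.2 ⟨hv, hcv⟩⟩
      omega
    have hlose : ∀ v ∈ solutionPairs n S, v.1 ∉ b (.inr v) ∨ 5 * n + v.2 ∉ b (.inr v) := by
      intro v hv
      by_contra! h
      have hm := hmem v hv
      have hle : (Finset.Icc (3 * n + 1) (5 * n)).card ≤ _ := Finset.card_le_card
        (t := (Finset.Icc 1 (8 * n + 1)).filter fun c =>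
          2 < ((delVoters n S).filter fun v => c ∈ b v).card) fun c hc => by
            rw [Finset.mem_Icc] at hc
            refine Finset.mem_filter.2 ⟨Finset.mem_Icc.2 (by omega), ?_⟩
            exact hbeat c (Finset.mem_Icc.2 (by omega)) v hv
              (hint _ (inr_mem_delVoters.2 hv) _ h.1 _ h.2 c (by omega) (by omega))
      rw [Nat.card_Icc] at hle
      omega
    have hkeep := endpoint_mem_of_price_le hS3 (fun v hv => by have := hmem v hv; omega)
      hprice hlose
    set T := (Finset.Icc 1 (3 * n)).filter fun j => ∃ a ∈ S j, j ∈ b (.inr (j, a))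
    obtain ⟨U, hU⟩ : ∃ U : Finset ℕ, ∀ a, a ∈ U ↔ a ∈ Finset.Icc 1 (3 * n) ∧
        ∀ j ∈ Finset.Icc 1 (3 * n), a ∈ S j → j ∉ b (.inr (j, a)) := by
      classical
      exact ⟨(Finset.Icc 1 (3 * n)).filter fun a =>
        ∀ j ∈ Finset.Icc 1 (3 * n), a ∈ S j → j ∉ b (.inr (j, a)), fun a => by
          simp only [Finset.mem_filter]⟩
    refine ⟨T, exists_cover_of_card_le (P := fun v => v.1 ∈ b (.inr v)) (U := U) hS3
      (fun j => Finset.mem_filter) hU ?_⟩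
    have hdisj : Disjoint T (U.image fun a => 5 * n + a) := by
      rw [Finset.disjoint_left]
      intro j hj hjU
      obtain ⟨a, ha, rfl⟩ := Finset.mem_image.1 hjU
      have := Finset.mem_Icc.1 (Finset.mem_filter.1 hj).1
      omega
    rw [← Finset.card_image_of_injective U (add_right_injective (5 * n)),
      ← Finset.card_union_of_disjoint hdisj]
    refine (Finset.card_le_card fun c hc => ?_).trans (Nat.le_of_lt_succ hfew)
    obtain hc | hc := Finset.mem_union.1 hc
    · obtain ⟨hcn, a, ha, hca⟩ := Finset.mem_filter.1 hc
      have hcn' := Finset.mem_Icc.1 hcn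
      refine Finset.mem_filter.2 ⟨Finset.mem_Icc.2 (by omega), ?_⟩
      exact hbeat c (Finset.mem_Icc.2 (by omega)) (c, a) (mem_solutionPairs.2 ⟨hcn, ha⟩) hca
    · obtain ⟨a, ha, rfl⟩ := Finset.mem_image.1 hc
      obtain ⟨han, hall⟩ := (hU a).1 ha
      have han' := Finset.mem_Icc.1 han
      refine Finset.mem_filter.2 ⟨Finset.mem_Icc.2 (by omega), ?_⟩
      rw [hscore]
      refine lt_of_lt_of_le ?_ (Nat.le_add_left _ _)
      change 3 ≤ _
      rw [← hocc a han,
        ← Finset.card_image_of_injective _ (Prod.mk_left_injective a)]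
      refine Finset.card_le_card fun v hv => ?_
      obtain ⟨j, hj, rfl⟩ := Finset.mem_image.1 hv
      obtain ⟨hj, haj⟩ := Finset.mem_filter.1 hj
      have hja : (j, a) ∈ solutionPairs n S := mem_solutionPairs.2 ⟨hj, haj⟩
      exact Finset.mem_filter.2 ⟨hja, (hkeep _ hja).resolve_left (hall j hj haj)⟩
  · rintro ⟨T, hT, hTcard, hcov⟩
    have hpT : 8 * n + 1 ∉ T := fun h => by
      have := Finset.mem_Icc.1 (hT h)
      omega
    have hWcard : (insert (8 * n + 1) T).card = n + 1 := by
      rw [Finset.card_insert_of_notMem hpT, hTcard]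
    refine ⟨coverBallot n T, fun v hv => coverBallot_subset hv,
      fun v _ => isAxisInterval_coverBallot n T v, sum_price_coverBallot_le hS3 T,
      insert (8 * n + 1) T, ?_, hWcard, Finset.mem_insert_self _ _, fun W' _ hW' => ?_⟩
    · refine Finset.insert_subset (by simp) (hT.trans (Finset.Icc_subset_Icc_right (by omega)))
    refine (Finset.sum_le_sum fun c _ => score_coverBallot_le hS hocc hT hcov c).trans
      (le_trans ?_ (Finset.sum_le_sum fun c hc => le_score_coverBallot hS3 hT hc))
    simp only [Finset.sum_add_distrib, Finset.sum_const, hW', hWcard, ← Finset.sum_filter,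
      Finset.filter_mem_eq_inter, smul_eq_mul]
    refine Nat.add_le_add_left (Nat.mul_le_mul_right 3 (Finset.card_le_card ?_)) _
    exact Finset.inter_subset_right.trans
      (Finset.subset_inter (Finset.subset_insert _ _) subset_rfl)
end

section
/- For the election constructed from a cubic graph G and integer h as described, there exists a set of at most 3h approval swaps after which the election is still CI with respect to the given societal axis and p belongs to some AV winning committee of size k = t(n+1) + (n−h) + 1, where t = 3h+1, if and only if G has an independent set of size h. -/
/-- Axis position of the vertex candidate `c_i` (`i : Fin n` represents `c_{i+1}`):
the axis is `t` fillers, `c_1`, `t` fillers, `c_2`, …, `c_n`, `t` fillers, `t` dummies, `p`,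
so `c_{i+1}` sits at position `(i+1)(t+1)` and `p` at position `t(n+2)+n+1`. -/
def vertexPos (t : ℕ) {n : ℕ} (i : Fin n) : ℕ := ((i : ℕ) + 1) * (t + 1)

/-- The smaller endpoint position of the edge voter of edge `e`. -/
def edgeLo (t : ℕ) {n : ℕ} (e : Sym2 (Fin n)) : ℕ :=
  Sym2.lift ⟨fun (a b : Fin n) => (min (a : ℕ) (b : ℕ) + 1) * (t + 1), fun a b => by simp [min_comm]⟩ e

/-- The larger endpoint position of the edge voter of edge `e`. -/
def edgeHi (t : ℕ) {n : ℕ} (e : Sym2 (Fin n)) : ℕ :=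
  Sym2.lift ⟨fun (a b : Fin n) => (max (a : ℕ) (b : ℕ) + 1) * (t + 1), fun a b => by simp [max_comm]⟩ e

/-- Voters: edge voters (`Sym2 (Fin n)`), vertex voters (`Fin n × ℕ`, copies), the `L - 3`
voters approving only `p` (`ℕ`, copies), and filler voters (`ℕ × ℕ`, group and copy). -/
abbrev SwapVoter (n : ℕ) : Type := Sym2 (Fin n) ⊕ ((Fin n × ℕ) ⊕ (ℕ ⊕ (ℕ × ℕ)))

/-- Ballots of the construction (all are axis intervals): the edge voter of `{c_a, c_b}`
approves `[c_a, c_b]`; each vertex voter of `c_i` approves the interval reaching `t`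
positions to each side of `c_i`; `p`-voters approve only `p`; each filler voter of group
`g` approves exactly the `g`-th group of `t` consecutive fillers. -/
def swapBallot (n t : ℕ) : SwapVoter n → Finset ℕ
  | .inl e => Finset.Icc (edgeLo t e) (edgeHi t e)
  | .inr (.inl (i, _)) => Finset.Icc (vertexPos t i - t) (vertexPos t i + t)
  | .inr (.inr (.inl _)) => {t * (n + 2) + n + 1}
  | .inr (.inr (.inr (g, _))) => Finset.Icc (g * (t + 1) + 1) (g * (t + 1) + t)

/-- The number of edge voters approving the vertex candidate `c_i`. -/
def edgeScore (n : ℕ) (G : SimpleGraph (Fin n)) [Fintype G.edgeSet] (t : ℕ) (i : Fin n) : ℕ :=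
  (G.edgeFinset.filter fun e => edgeLo t e ≤ vertexPos t i ∧ vertexPos t i ≤ edgeHi t e).card

/-- The voter collection: one edge voter per edge of `G`; for each vertex candidate `c_i`
enough vertex voters that, together with the edge voters, `c_i` has score `L`; `L - 3`
voters approving only `p`; and `L + 4t` filler voters per each of the `n + 1` groups. -/
def swapVoters (n : ℕ) (G : SimpleGraph (Fin n)) [Fintype G.edgeSet] [DecidableEq (Fin n)]
    (t L : ℕ) : Finset (SwapVoter n) :=
  G.edgeFinset.disjSum
    ((((Finset.univ : Finset (Fin n)) ×ˢ Finset.range (L + 1)).filter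
        fun q => q.2 < L - edgeScore n G t q.1).disjSum
      ((Finset.range (L - 3)).disjSum
        (Finset.range (n + 1) ×ˢ Finset.range (L + 4 * t))))

open Finset

/-- The approval score of candidate `c` when the voters cast the ballots `b`. -/
def swapScore (n : ℕ) (G : SimpleGraph (Fin n)) [Fintype G.edgeSet] (t L : ℕ)
    (b : SwapVoter n → Finset ℕ) (c : ℕ) : ℕ :=
  ((swapVoters n G t L).filter fun v => c ∈ b v).card

section Committee

variable {α : Type*} [DecidableEq α]

theorem sum_le_sum_of_threshold {C W W' : Finset α} {f : α → ℕ} {θ : ℕ}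
    (hin : ∀ c ∈ W, θ ≤ f c) (hout : ∀ c ∈ C, c ∉ W → f c ≤ θ)
    (hW' : W' ⊆ C) (hcard : W'.card = W.card) : ∑ c ∈ W', f c ≤ ∑ c ∈ W, f c := by
  have h₁ : ∑ c ∈ W' \ W, f c ≤ (W' \ W).card * θ :=
    sum_le_card_nsmul _ _ _ fun c hc => by
      rw [mem_sdiff] at hc
      exact hout c (hW' hc.1) hc.2
  have h₂ : (W \ W').card * θ ≤ ∑ c ∈ W \ W', f c :=
    card_nsmul_le_sum _ _ _ fun c hc => hin c (mem_sdiff.1 hc).1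
  rw [card_sdiff_comm hcard] at h₁
  have h₃ := sum_inter_add_sum_sdiff W' W f
  have h₄ := sum_inter_add_sum_sdiff W W' f
  rw [inter_comm] at h₄
  omega

theorem le_of_notMem_of_optimal {C W : Finset α} {f : α → ℕ} {p c : α}
    (hW : W ⊆ C) (hp : p ∈ W) (hc : c ∈ C) (hcW : c ∉ W)
    (hopt : ∀ W' ⊆ C, W'.card = W.card → ∑ x ∈ W', f x ≤ ∑ x ∈ W, f x) : f c ≤ f p := by
  have hce : c ∉ W.erase p := fun hh => hcW (mem_of_mem_erase hh)
  have h₁ := hopt (insert c (W.erase p))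
    (insert_subset hc ((erase_subset _ _).trans hW))
    (by rw [card_insert_of_notMem hce, card_erase_add_one hp])
  rw [sum_insert hce, ← add_sum_erase W f hp] at h₁
  omega

end Committee

section Intervals

theorem sdiff_eq_empty_of_endpoints_mem {a b : ℕ} {J : Finset ℕ} (hJ : IsAxisInterval J)
    (ha : a ∈ J) (hb : b ∈ J) : Icc a b \ J = ∅ := by
  rw [sdiff_eq_empty_iff_subset]
  intro x hx
  rw [mem_Icc] at hx
  exact hJ a ha b hb x hx.1 hx.2

theorem eq_endpoint_of_mem_sdiff {a b x : ℕ} {J : Finset ℕ} (hJ : IsAxisInterval J)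
    (ha : a + 1 ∈ J) (hb : b - 1 ∈ J) (hx : x ∈ Icc a b \ J) : x = a ∨ x = b := by
  rw [mem_sdiff, mem_Icc] at hx
  by_contra! hne
  exact hx.2 (hJ _ ha _ hb x (by omega) (by omega))

theorem endpoint_mem_of_card_eq {a b : ℕ} {J : Finset ℕ} (hJ : IsAxisInterval J)
    (hab : a < b) (ha : a + 1 ∈ J) (hcard : J.card = (Icc a b).card) : a ∈ J ∨ b ∈ J := by
  by_contra! hne
  have hsub : J ⊆ Icc (a + 1) (b - 1) := by
    intro x hx
    rw [mem_Icc]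
    constructor
    · by_contra! hlt
      exact hne.1 (hJ x hx _ ha a (by omega) (by omega))
    · by_contra! hlt
      exact hne.2 (hJ _ ha x hx b (by omega) (by omega))
  have := card_le_card hsub
  rw [hcard, Nat.card_Icc, Nat.card_Icc] at this
  omega

theorem le_card_sdiff_of_mem_top {I J : Finset ℕ} {t P : ℕ} (hJ : IsAxisInterval J)
    (hJP : J ⊆ Icc 1 P) (hP : P ∈ J) (hcard : J.card = I.card) (ht : t ≤ I.card)
    (hI : ∀ x ∈ I, x + t ≤ P) : t ≤ (I \ J).card := by
  rw [← card_sdiff_comm hcard]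
  have hcP := card_le_card hJP
  rw [Nat.card_Icc] at hcP
  have hsub : Icc (P + 1 - t) P ⊆ J \ I := by
    intro x hx
    rw [mem_Icc] at hx
    refine mem_sdiff.2 ⟨?_, fun hxI => ?_⟩
    · by_contra hxJ
      have hJx : J ⊆ Icc (x + 1) P := by
        intro y hy
        rw [mem_Icc]
        refine ⟨?_, (mem_Icc.1 (hJP hy)).2⟩
        by_contra! hlt
        exact hxJ (hJ y hy P hP x (by omega) hx.2)
      have := card_le_card hJx
      rw [Nat.card_Icc] at this
      omega
    · have := hI x hxI
      omega
  have := card_le_card hsub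
  rw [Nat.card_Icc] at this
  omega

end Intervals

section Axis

variable {n t : ℕ}

theorem dvd_vertexPos (i : Fin n) : t + 1 ∣ vertexPos t i := Dvd.intro_left _ rfl

theorem vertexPos_injective : Function.Injective (vertexPos t : Fin n → ℕ) := by
  intro i j hij
  have := Nat.eq_of_mul_eq_mul_right (Nat.succ_pos t) hij
  exact Fin.ext (by omega)

theorem vertexPos_lt_vertexPos {i j : Fin n} (hij : i < j) :
    vertexPos t i + (t + 1) ≤ vertexPos t j := by
  have h₁ : (i : ℕ) + 1 + 1 ≤ (j : ℕ) + 1 := by have : (i : ℕ) < j := hij; omega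
  have h₂ := Nat.mul_le_mul_right (t + 1) h₁
  unfold vertexPos
  linarith

theorem le_vertexPos (i : Fin n) : t + 1 ≤ vertexPos t i :=
  Nat.le_mul_of_pos_left _ (Nat.succ_pos _)

theorem vertexPos_le (i : Fin n) : vertexPos t i ≤ n * (t + 1) :=
  Nat.mul_le_mul_right _ i.isLt

theorem not_dvd_add_of_dvd {m d x : ℕ} (hd : 0 < d) (hdm : d < m) (hx : m ∣ x) : ¬ m ∣ x + d :=
  fun hh => Nat.not_dvd_of_pos_of_lt hd hdm ((Nat.dvd_add_right hx).1 hh)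

theorem not_dvd_sub_of_dvd {m d x : ℕ} (hd : 0 < d) (hdm : d < m) (hx : m ∣ x) (hdx : d ≤ x) :
    ¬ m ∣ x - d := fun hh => by
  have := not_dvd_add_of_dvd hd hdm hh
  rw [Nat.sub_add_cancel hdx] at this
  exact this hx

theorem preferredPos_eq : t * (n + 2) + n + 1 = n * (t + 1) + (2 * t + 1) := by ring

theorem not_dvd_preferredPos (ht : 1 ≤ t) : ¬ t + 1 ∣ t * (n + 2) + n + 1 := by
  have h₁ : t * (n + 2) + n + 1 = (n + 1) * (t + 1) + t := by ring
  rw [h₁]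
  exact not_dvd_add_of_dvd (by omega) (by omega) (Dvd.intro_left _ rfl)

theorem axis_cases {c : ℕ} (hc₁ : 1 ≤ c) (hc₂ : c ≤ n * (t + 1) + t) :
    (∃ i : Fin n, c = vertexPos t i) ∨
      ∃ g < n + 1, c ∈ Icc (g * (t + 1) + 1) (g * (t + 1) + t) := by
  have hdiv := Nat.div_add_mod' c (t + 1)
  have hmod : c % (t + 1) < t + 1 := Nat.mod_lt c (Nat.succ_pos t)
  have hg : c / (t + 1) < n + 1 := by
    rw [Nat.div_lt_iff_lt_mul (Nat.succ_pos t)]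
    linarith
  rcases Nat.eq_zero_or_pos (c % (t + 1)) with h0 | h0
  · left
    rw [h0, add_zero] at hdiv
    have hpos : 0 < c / (t + 1) := by
      rcases Nat.eq_zero_or_pos (c / (t + 1)) with h1 | h1
      · rw [h1] at hdiv
        omega
      · exact h1
    refine ⟨⟨c / (t + 1) - 1, by omega⟩, ?_⟩
    unfold vertexPos
    rw [Nat.sub_add_cancel hpos, hdiv]
  · right
    refine ⟨c / (t + 1), hg, ?_⟩
    rw [mem_Icc]
    omega

theorem edgeLo_mk {a b : Fin n} (hab : a < b) : edgeLo t s(a, b) = vertexPos t a := by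
  have : (a : ℕ) ≤ b := hab.le
  simp [edgeLo, vertexPos, this]

theorem edgeHi_mk {a b : Fin n} (hab : a < b) : edgeHi t s(a, b) = vertexPos t b := by
  have : (a : ℕ) ≤ b := hab.le
  simp [edgeHi, vertexPos, this]

theorem exists_lt_of_mem_edgeFinset {G : SimpleGraph (Fin n)} [Fintype G.edgeSet]
    {e : Sym2 (Fin n)} (he : e ∈ G.edgeFinset) : ∃ a b, a < b ∧ e = s(a, b) := by
  induction e with
  | _ a b =>
    have hadj : G.Adj a b := by simpa using he
    rcases lt_or_gt_of_ne hadj.ne with hlt | hlt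
    · exact ⟨a, b, hlt, rfl⟩
    · exact ⟨b, a, hlt, Sym2.eq_swap⟩

end Axis

section Scores

variable {n : ℕ} {G : SimpleGraph (Fin n)} [Fintype G.edgeSet] {t L : ℕ}

theorem card_filter_disjSum_eq {α β : Type*} (A : Finset α) (B : Finset β)
    (q : α ⊕ β → Prop) [DecidablePred q] :
    ((A.disjSum B).filter q).card
      = (A.filter fun a => q (.inl a)).card + (B.filter fun b => q (.inr b)).card := by
  simp only [card_filter, sum_disjSum]

theorem score_le_add_lost (b b' : SwapVoter n → Finset ℕ) (c : ℕ) :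
    swapScore n G t L b c ≤ swapScore n G t L b' c +
      swapScore n G t L (fun v => b v \ b' v) c := by
  unfold swapScore
  refine (card_le_card ?_).trans (card_union_le _ _)
  intro v hv
  simp only [mem_union, mem_filter, mem_sdiff] at hv ⊢
  tauto

theorem sum_swapScore_le (b : SwapVoter n → Finset ℕ) (X : Finset ℕ) :
    ∑ c ∈ X, swapScore n G t L b c = ∑ v ∈ swapVoters n G t L, (X ∩ b v).card := by
  have h₁ := sum_card_bipartiteAbove_eq_sum_card_bipartiteBelow
    (s := X) (t := swapVoters n G t L) (fun c v => c ∈ b v)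
  simpa only [swapScore, bipartiteAbove, bipartiteBelow, filter_mem_eq_inter] using h₁

theorem edgeScore_le (i : Fin n) : edgeScore n G t i ≤ G.edgeFinset.card := card_filter_le _ _

theorem mem_vertexBallot_iff {i j : Fin n} :
    vertexPos t j ∈ Icc (vertexPos t i - t) (vertexPos t i + t) ↔ i = j := by
  rw [mem_Icc]
  constructor
  · intro hh
    rcases lt_trichotomy i j with hlt | heq | hgt
    · have := vertexPos_lt_vertexPos (t := t) hlt
      omega
    · exact heq
    · have := vertexPos_lt_vertexPos (t := t) hgt
      omega
  · rintro rfl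
    omega

theorem not_dvd_of_mem_filler {g x : ℕ} (hx : x ∈ Icc (g * (t + 1) + 1) (g * (t + 1) + t)) :
    ¬ t + 1 ∣ x := by
  rw [mem_Icc] at hx
  have h₁ : x = g * (t + 1) + (x - g * (t + 1)) := by omega
  rw [h₁]
  exact not_dvd_add_of_dvd (by omega) (by omega) (Dvd.intro_left _ rfl)

theorem swapScore_vertexPos (ht : 1 ≤ t) (hL : L = G.edgeFinset.card) (i : Fin n) :
    swapScore n G t L (swapBallot n t) (vertexPos t i) = L := by
  unfold swapScore swapVoters
  rw [card_filter_disjSum_eq, card_filter_disjSum_eq, card_filter_disjSum_eq]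
  have h₁ : (G.edgeFinset.filter fun e => vertexPos t i ∈ swapBallot n t (.inl e)).card
      = edgeScore n G t i := by
    simp only [edgeScore, swapBallot, mem_Icc]
  have h₂ : ((((univ : Finset (Fin n)) ×ˢ range (L + 1)).filter
      fun q => q.2 < L - edgeScore n G t q.1).filter
        fun q => vertexPos t i ∈ swapBallot n t (.inr (.inl q)))
      = {i} ×ˢ range (L - edgeScore n G t i) := by
    ext ⟨j, m⟩
    simp only [mem_filter, mem_product, mem_univ, mem_range, true_and, swapBallot,
      mem_vertexBallot_iff, mem_singleton]
    constructor
    · rintro ⟨⟨_, hm⟩, rfl⟩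
      exact ⟨rfl, hm⟩
    · rintro ⟨rfl, hm⟩
      exact ⟨⟨by omega, hm⟩, rfl⟩
  have h₃ : ((range (L - 3)).filter
      fun q => vertexPos t i ∈ swapBallot n t (.inr (.inr (.inl q)))) = ∅ := by
    refine filter_eq_empty_iff.2 fun q _ hq => ?_
    simp only [swapBallot, mem_singleton] at hq
    exact not_dvd_preferredPos ht (hq ▸ dvd_vertexPos i)
  have h₄ : ((range (n + 1) ×ˢ range (L + 4 * t)).filter
      fun q => vertexPos t i ∈ swapBallot n t (.inr (.inr (.inr q)))) = ∅ :=
    filter_eq_empty_iff.2 fun q _ hq => not_dvd_of_mem_filler hq (dvd_vertexPos i)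
  rw [h₁, h₂, h₃, h₄]
  have := edgeScore_le (G := G) (t := t) i
  simp
  omega

theorem le_swapScore_filler {b : SwapVoter n → Finset ℕ}
    (hb : ∀ q, b (.inr (.inr (.inr q))) = swapBallot n t (.inr (.inr (.inr q))))
    {g c : ℕ} (hg : g < n + 1) (hc : c ∈ Icc (g * (t + 1) + 1) (g * (t + 1) + t)) :
    L + 4 * t ≤ swapScore n G t L b c := by
  unfold swapScore swapVoters
  rw [card_filter_disjSum_eq, card_filter_disjSum_eq, card_filter_disjSum_eq]
  have h₁ : {g} ×ˢ range (L + 4 * t) ⊆ (range (n + 1) ×ˢ range (L + 4 * t)).filter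
      fun q => c ∈ b (.inr (.inr (.inr q))) := by
    rintro ⟨g', m⟩ hq
    simp only [mem_product, mem_singleton, mem_range] at hq
    obtain ⟨rfl, hm⟩ := hq
    simp only [mem_filter, mem_product, mem_range, hb]
    exact ⟨⟨hg, hm⟩, hc⟩
  have h₂ := card_le_card h₁
  simp only [card_product, card_singleton, card_range, one_mul] at h₂
  omega

theorem mem_swapVoters_edge {e : Sym2 (Fin n)} :
    (.inl e : SwapVoter n) ∈ swapVoters n G t L ↔ e ∈ G.edgeFinset := by
  simp [swapVoters]

end Scores

section Bribery

variable {n : ℕ} {G : SimpleGraph (Fin n)} [Fintype G.edgeSet] {t L : ℕ}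

theorem card_incident_edges [DecidableRel G.Adj] (hcubic : ∀ v : Fin n, G.degree v = 3)
    (i : Fin n) : (G.edgeFinset.filter fun e => i ∈ e).card = 3 := by
  rw [← hcubic i, ← G.card_incidenceFinset_eq_degree i, G.incidenceFinset_eq_filter]

theorem three_le_card_edgeFinset [DecidableRel G.Adj] (hn : 1 ≤ n)
    (hcubic : ∀ v : Fin n, G.degree v = 3) : 3 ≤ G.edgeFinset.card := by
  rw [← card_incident_edges hcubic ⟨0, hn⟩]
  exact card_filter_le _ _

theorem swapBallot_edge {a c : Fin n} (hac : a < c) :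
    swapBallot n t (.inl s(a, c)) = Icc (vertexPos t a) (vertexPos t c) := by
  simp only [swapBallot, edgeLo_mk hac, edgeHi_mk hac]

theorem swapBallot_mem_bounds {v : SwapVoter n} (hv : v ∈ swapVoters n G t L)
    (hvp : ∀ q, v ≠ .inr (.inr (.inl q))) :
    t ≤ (swapBallot n t v).card ∧
      ∀ x ∈ swapBallot n t v, 1 ≤ x ∧ x ≤ n * (t + 1) + t := by
  rcases v with e | ⟨i, m⟩ | q | ⟨g, m⟩
  · obtain ⟨a, c, hac, rfl⟩ := exists_lt_of_mem_edgeFinset (mem_swapVoters_edge.1 hv)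
    have h₁ := vertexPos_lt_vertexPos (t := t) hac
    have h₂ := vertexPos_le (t := t) c
    have h₃ := le_vertexPos (t := t) a
    rw [swapBallot_edge hac, Nat.card_Icc]
    refine ⟨by omega, fun x hx => ?_⟩
    rw [mem_Icc] at hx
    omega
  · have h₂ := vertexPos_le (t := t) i
    have h₃ := le_vertexPos (t := t) i
    simp only [swapBallot, Nat.card_Icc, mem_Icc]
    exact ⟨by omega, fun x hx => by omega⟩
  · exact absurd rfl (hvp q)
  · have hg : g < n + 1 := by
      simp [swapVoters] at hv
      omega
    have h₁ := Nat.mul_le_mul_right (t + 1) (Nat.le_of_lt_succ hg)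
    simp only [swapBallot, Nat.card_Icc, mem_Icc]
    exact ⟨by omega, fun x hx => by omega⟩

theorem lost_le_cost (b b' : SwapVoter n → Finset ℕ) (c : ℕ) :
    swapScore n G t L (fun v => b v \ b' v) c
      ≤ ∑ v ∈ swapVoters n G t L, (b v \ b' v).card := by
  have h₁ := sum_swapScore_le (G := G) (t := t) (L := L) (fun v => b v \ b' v) {c}
  rw [sum_singleton] at h₁
  rw [h₁]
  exact sum_le_sum fun v _ => card_le_card inter_subset_right

theorem swapScore_preferred_le {b' : SwapVoter n → Finset ℕ}
    (hvalid : ∀ v ∈ swapVoters n G t L,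
      (b' v).card = (swapBallot n t v).card ∧
      b' v ⊆ Icc 1 (t * (n + 2) + n + 1) ∧ IsAxisInterval (b' v))
    (hcost : ∑ v ∈ swapVoters n G t L, (swapBallot n t v \ b' v).card < t) :
    swapScore n G t L b' (t * (n + 2) + n + 1) ≤ L - 3 := by
  have h₁ : (swapVoters n G t L).filter (fun v => t * (n + 2) + n + 1 ∈ b' v)
      ⊆ (range (L - 3)).image fun q => (.inr (.inr (.inl q)) : SwapVoter n) := by
    intro v hv
    rw [mem_filter] at hv
    obtain ⟨hv, hmem⟩ := hv
    by_cases hvp : ∀ q, v ≠ .inr (.inr (.inl q))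
    · exfalso
      obtain ⟨hcard, hsub, hint⟩ := hvalid v hv
      obtain ⟨hsize, hbound⟩ := swapBallot_mem_bounds hv hvp
      have h₂ := le_card_sdiff_of_mem_top hint hsub hmem hcard hsize fun x hx => by
        rw [preferredPos_eq]
        have := (hbound x hx).2
        omega
      have h₃ := single_le_sum (f := fun v => (swapBallot n t v \ b' v).card)
        (fun _ _ => Nat.zero_le _) hv
      omega
    · push Not at hvp
      obtain ⟨q, rfl⟩ := hvp
      rw [mem_image]
      exact ⟨q, by simpa [swapVoters] using hv, rfl⟩
  have h₂ := (card_le_card h₁).trans card_image_le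
  rwa [card_range] at h₂

/-- If every candidate removed from a ballot is a vertex candidate, then only edge voters have
changed their ballots, and an edge voter loses only endpoints of its edge. -/
theorem mem_edge_of_lost {b' : SwapVoter n → Finset ℕ} (ht : 1 ≤ t)
    (hvalid : ∀ v ∈ swapVoters n G t L, IsAxisInterval (b' v))
    (hlost : ∀ v ∈ swapVoters n G t L, ∀ x ∈ swapBallot n t v \ b' v, t + 1 ∣ x)
    {v : SwapVoter n} (hv : v ∈ swapVoters n G t L) {i : Fin n}
    (hi : vertexPos t i ∈ swapBallot n t v \ b' v) :
    ∃ e ∈ G.edgeFinset, v = .inl e ∧ i ∈ e := by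
  have hkeep : ∀ x ∈ swapBallot n t v, ¬ t + 1 ∣ x → x ∈ b' v := by
    intro x hx hxd
    by_contra hxb
    exact hxd (hlost v hv x (mem_sdiff.2 ⟨hx, hxb⟩))
  rcases v with e | ⟨j, m⟩ | q | ⟨g, m⟩
  · have he := mem_swapVoters_edge.1 hv
    refine ⟨e, he, rfl, ?_⟩
    obtain ⟨a, c, hac, rfl⟩ := exists_lt_of_mem_edgeFinset he
    rw [swapBallot_edge hac] at hi hkeep
    have h₁ := vertexPos_lt_vertexPos (t := t) hac
    have h₂ := le_vertexPos (t := t) c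
    have hsucc := hkeep (vertexPos t a + 1) (by rw [mem_Icc]; omega)
      (not_dvd_add_of_dvd (by omega) (by omega) (dvd_vertexPos a))
    have hpred := hkeep (vertexPos t c - 1) (by rw [mem_Icc]; omega)
      (not_dvd_sub_of_dvd (by omega) (by omega) (dvd_vertexPos c) (by omega))
    rw [Sym2.mem_iff]
    exact (eq_endpoint_of_mem_sdiff (hvalid _ hv) hsucc hpred hi).imp
      (fun hh => vertexPos_injective hh) (fun hh => vertexPos_injective hh)
  · exfalso
    have h₂ := le_vertexPos (t := t) j
    have hlo := hkeep (vertexPos t j - t) (by simp only [swapBallot, mem_Icc]; omega)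
      (not_dvd_sub_of_dvd (by omega) (by omega) (dvd_vertexPos j) (by omega))
    have hhi := hkeep (vertexPos t j + t) (by simp only [swapBallot, mem_Icc]; omega)
      (not_dvd_add_of_dvd (by omega) (by omega) (dvd_vertexPos j))
    have hemp := sdiff_eq_empty_of_endpoints_mem (hvalid _ hv) hlo hhi
    simp only [swapBallot] at hi
    rw [hemp] at hi
    exact notMem_empty _ hi
  · exfalso
    have h₁ := (mem_sdiff.1 hi).1
    simp only [swapBallot, mem_singleton] at h₁
    exact not_dvd_preferredPos ht (h₁ ▸ dvd_vertexPos i)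
  · exact absurd (dvd_vertexPos i) (not_dvd_of_mem_filler (mem_sdiff.1 hi).1)

theorem exists_independent_of_bribery [DecidableRel G.Adj] (hn : 1 ≤ n)
    (hcubic : ∀ v : Fin n, G.degree v = 3) {h : ℕ} (hhn : h ≤ n) (ht : t = 3 * h + 1)
    (hL : L = G.edgeFinset.card) {b' : SwapVoter n → Finset ℕ}
    (hvalid : ∀ v ∈ swapVoters n G t L,
      (b' v).card = (swapBallot n t v).card ∧
      b' v ⊆ Icc 1 (t * (n + 2) + n + 1) ∧ IsAxisInterval (b' v))
    (hcost : ∑ v ∈ swapVoters n G t L, (swapBallot n t v \ b' v).card ≤ 3 * h)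
    {W : Finset ℕ} (hW : W ⊆ Icc 1 (t * (n + 2) + n + 1))
    (hWcard : W.card = t * (n + 1) + (n - h) + 1) (hpW : t * (n + 2) + n + 1 ∈ W)
    (hopt : ∀ W' ⊆ Icc 1 (t * (n + 2) + n + 1), W'.card = W.card →
      ∑ c ∈ W', swapScore n G t L b' c ≤ ∑ c ∈ W, swapScore n G t L b' c) :
    ∃ s : Finset (Fin n), s.card = h ∧ ∀ u ∈ s, ∀ w ∈ s, ¬ G.Adj u w := by
  have hL3 : 3 ≤ L := hL ▸ three_le_card_edgeFinset hn hcubic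
  have hp := swapScore_preferred_le hvalid (by omega)
  have hout : ∀ c ∈ Icc 1 (t * (n + 2) + n + 1), c ∉ W → swapScore n G t L b' c ≤ L - 3 :=
    fun c hc hcW => (le_of_notMem_of_optimal hW hpW hc hcW hopt).trans hp
  set H : Finset (Fin n) := univ.filter fun i => vertexPos t i ∉ W with hH
  have hcompl : Icc 1 (t * (n + 2) + n + 1) \ W
      ⊆ Ico (n * (t + 1) + t + 1) (t * (n + 2) + n + 1) ∪ H.image (vertexPos t) := by
    intro c hc
    rw [mem_sdiff] at hc
    obtain ⟨hc, hcW⟩ := hc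
    have hcP : c ≠ t * (n + 2) + n + 1 := fun hh => hcW (hh ▸ hpW)
    have hc' := mem_Icc.1 hc
    rw [mem_union, mem_Ico]
    by_cases hcd : n * (t + 1) + t + 1 ≤ c
    · left
      omega
    · right
      rcases axis_cases hc'.1 (n := n) (t := t) (by omega) with ⟨i, rfl⟩ | ⟨g, hg, hcg⟩
      · exact mem_image_of_mem _ (by simp [hH, hcW])
      · exfalso
        have h₁ := le_swapScore_filler (G := G) (L := L) (fun _ => rfl) hg hcg
        have h₂ := score_le_add_lost (G := G) (t := t) (L := L) (swapBallot n t) b' c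
        have h₃ := lost_le_cost (G := G) (t := t) (L := L) (swapBallot n t) b' c
        have h₄ := hout c hc hcW
        omega
  have hHcard : h ≤ H.card := by
    have h₁ := (card_le_card hcompl).trans (card_union_le _ _)
    rw [card_sdiff_of_subset hW, Nat.card_Icc, Nat.card_Ico, hWcard,
      card_image_of_injective _ vertexPos_injective, preferredPos_eq] at h₁
    have h₂ : t * (n + 1) = n * (t + 1) + t - n := by
      have : n * (t + 1) + t = t * (n + 1) + n := by ring
      omega
    have h₃ : n ≤ n * (t + 1) := Nat.le_mul_of_pos_right _ (Nat.succ_pos t)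
    omega
  have hloss : ∀ i ∈ H, 3 ≤ swapScore n G t L (fun v => swapBallot n t v \ b' v)
      (vertexPos t i) := by
    intro i hi
    have h₁ := score_le_add_lost (G := G) (t := t) (L := L) (swapBallot n t) b' (vertexPos t i)
    rw [swapScore_vertexPos (by omega) hL] at h₁
    have h₂ := hout (vertexPos t i) (by
      have h₃ := le_vertexPos (t := t) i
      have h₄ := vertexPos_le (t := t) i
      rw [mem_Icc, preferredPos_eq]
      omega) (mem_filter.1 hi).2
    omega
  have hlostH : ∀ v ∈ swapVoters n G t L,
      swapBallot n t v \ b' v ⊆ H.image (vertexPos t) := by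
    have h₁ := sum_swapScore_le (G := G) (t := t) (L := L)
      (fun v => swapBallot n t v \ b' v) (H.image (vertexPos t))
    rw [sum_image fun _ _ _ _ hh => vertexPos_injective hh] at h₁
    have h₂ := card_nsmul_le_sum _ _ _ hloss
    rw [h₁, smul_eq_mul] at h₂
    have h₃ : ∀ v ∈ swapVoters n G t L,
        (H.image (vertexPos t) ∩ (swapBallot n t v \ b' v)).card
          ≤ (swapBallot n t v \ b' v).card := fun v _ => card_le_card inter_subset_right
    have h₄ := (sum_eq_sum_iff_of_le h₃).1 (le_antisymm (sum_le_sum h₃) (by omega))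
    intro v hv
    exact inter_eq_right.1 (eq_of_subset_of_card_le inter_subset_right (h₄ v hv).ge)
  have hdvd : ∀ v ∈ swapVoters n G t L, ∀ x ∈ swapBallot n t v \ b' v, t + 1 ∣ x := by
    intro v hv x hx
    obtain ⟨i, _, rfl⟩ := mem_image.1 (hlostH v hv hx)
    exact dvd_vertexPos i
  have hincident : ∀ i ∈ H, ∀ e ∈ G.edgeFinset, i ∈ e → vertexPos t i ∉ b' (.inl e) := by
    intro i hi e he hie
    have h₁ : (swapVoters n G t L).filter
        (fun v => vertexPos t i ∈ swapBallot n t v \ b' v) ⊆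
          (G.edgeFinset.filter fun e => i ∈ e).map ⟨Sum.inl, Sum.inl_injective⟩ := by
      intro v hv
      rw [mem_filter] at hv
      obtain ⟨e, he, rfl, hie⟩ := mem_edge_of_lost (by omega)
        (fun v hv => (hvalid v hv).2.2) hdvd hv.1 hv.2
      exact mem_map_of_mem ⟨Sum.inl, Sum.inl_injective⟩ (mem_filter.2 ⟨he, hie⟩)
    have h₂ := eq_of_subset_of_card_le h₁ (by
      rw [card_map, card_incident_edges hcubic]
      exact hloss i hi)
    have h₃ : (.inl e : SwapVoter n) ∈ (swapVoters n G t L).filter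
        (fun v => vertexPos t i ∈ swapBallot n t v \ b' v) := by
      rw [h₂]
      exact mem_map_of_mem ⟨Sum.inl, Sum.inl_injective⟩ (mem_filter.2 ⟨he, hie⟩)
    exact (mem_sdiff.1 (mem_filter.1 h₃).2).2
  have hindep : ∀ u ∈ H, ∀ w ∈ H, u < w → ¬ G.Adj u w := by
    intro u hu w hw huw hadj
    have he : s(u, w) ∈ G.edgeFinset := by simpa using hadj
    have hv : (.inl s(u, w) : SwapVoter n) ∈ swapVoters n G t L := mem_swapVoters_edge.2 he
    obtain ⟨hcard, _, hint⟩ := hvalid _ hv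
    have hlost := hdvd _ hv
    rw [swapBallot_edge huw] at hcard hlost
    have h₁ := vertexPos_lt_vertexPos (t := t) huw
    have hsucc : vertexPos t u + 1 ∈ b' (.inl s(u, w)) := by
      by_contra hnot
      exact not_dvd_add_of_dvd (by omega) (by omega) (dvd_vertexPos u)
        (hlost _ (mem_sdiff.2 ⟨by rw [mem_Icc]; omega, hnot⟩))
    rcases endpoint_mem_of_card_eq hint (by omega) hsucc hcard with hmem | hmem
    · exact hincident u hu _ he (Sym2.mem_mk_left u w) hmem
    · exact hincident w hw _ he (Sym2.mem_mk_right u w) hmem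
  obtain ⟨s, hsH, hs⟩ := exists_subset_card_eq hHcard
  refine ⟨s, hs, fun u hu w hw hadj => ?_⟩
  rcases lt_or_gt_of_ne hadj.ne with hlt | hlt
  · exact hindep u (hsH hu) w (hsH hw) hlt hadj
  · exact hindep w (hsH hw) u (hsH hu) hlt hadj.symm

/-- The ballots after the bribery that shifts, for every vertex of `s`, its incident edge voters
by one position away from that vertex. -/
def bribedBallot (n t : ℕ) (s : Finset (Fin n)) : SwapVoter n → Finset ℕ
  | .inl e =>
    if ∃ i ∈ s, edgeLo t e = vertexPos t i then Icc (edgeLo t e + 1) (edgeHi t e + 1)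
    else if ∃ i ∈ s, edgeHi t e = vertexPos t i then Icc (edgeLo t e - 1) (edgeHi t e - 1)
    else Icc (edgeLo t e) (edgeHi t e)
  | .inr v => swapBallot n t (.inr v)

theorem bribedBallot_edge (s : Finset (Fin n)) {a c : Fin n} (hac : a < c) :
    bribedBallot n t s (.inl s(a, c)) =
      if a ∈ s then Icc (vertexPos t a + 1) (vertexPos t c + 1)
      else if c ∈ s then Icc (vertexPos t a - 1) (vertexPos t c - 1)
      else Icc (vertexPos t a) (vertexPos t c) := by
  simp only [bribedBallot, edgeLo_mk hac, edgeHi_mk hac, vertexPos_injective.eq_iff,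
    exists_eq_right']

theorem isAxisInterval_Icc (a b : ℕ) : IsAxisInterval (Icc a b) := by
  intro x hx y hy z hxz hzy
  rw [mem_Icc] at *
  omega

theorem bribedBallot_valid (s : Finset (Fin n)) (ht : 1 ≤ t) {v : SwapVoter n}
    (hv : v ∈ swapVoters n G t L) :
    (bribedBallot n t s v).card = (swapBallot n t v).card ∧
      bribedBallot n t s v ⊆ Icc 1 (t * (n + 2) + n + 1) ∧
      IsAxisInterval (bribedBallot n t s v) := by
  have hbounds := swapBallot_mem_bounds hv
  have hP := preferredPos_eq (n := n) (t := t)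
  rcases v with e | ⟨i, m⟩ | q | ⟨g, m⟩
  · obtain ⟨a, c, hac, rfl⟩ := exists_lt_of_mem_edgeFinset (mem_swapVoters_edge.1 hv)
    have h₁ := vertexPos_lt_vertexPos (t := t) hac
    have h₂ := vertexPos_le (t := t) c
    have h₃ := le_vertexPos (t := t) a
    rw [bribedBallot_edge s hac, swapBallot_edge hac, hP]
    split_ifs
    all_goals
      refine ⟨?_, ?_, isAxisInterval_Icc _ _⟩
      · simp only [Nat.card_Icc] <;> omega
      · exact Icc_subset_Icc (by omega) (by omega)
  · refine ⟨rfl, fun x hx => ?_, isAxisInterval_Icc _ _⟩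
    have := (hbounds (by simp)).2 x hx
    rw [mem_Icc]
    omega
  · refine ⟨rfl, fun x hx => ?_, ?_⟩
    · simp only [bribedBallot, swapBallot, mem_singleton] at hx
      rw [mem_Icc]
      omega
    · intro x hx y hy z hxz hzy
      simp only [bribedBallot, swapBallot, mem_singleton] at *
      omega
  · refine ⟨rfl, fun x hx => ?_, isAxisInterval_Icc _ _⟩
    have := (hbounds (by simp)).2 x hx
    rw [mem_Icc]
    omega

theorem bribery_cost_le [DecidableRel G.Adj] (hcubic : ∀ v : Fin n, G.degree v = 3)
    (s : Finset (Fin n)) :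
    ∑ v ∈ swapVoters n G t L, (swapBallot n t v \ bribedBallot n t s v).card
      ≤ 3 * s.card := by
  have h₁ : ∀ e ∈ G.edgeFinset, (swapBallot n t (.inl e) \ bribedBallot n t s (.inl e)).card
      ≤ if ∃ i ∈ s, i ∈ e then 1 else 0 := by
    intro e he
    obtain ⟨a, c, hac, rfl⟩ := exists_lt_of_mem_edgeFinset he
    rw [bribedBallot_edge s hac, swapBallot_edge hac]
    by_cases ha : a ∈ s
    · rw [if_pos ha, if_pos ⟨a, ha, Sym2.mem_mk_left a c⟩]
      refine (card_le_card (t := {vertexPos t a}) fun x hx => ?_).trans_eq (card_singleton _)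
      simp only [mem_sdiff, mem_Icc, mem_singleton] at hx ⊢
      omega
    · by_cases hc : c ∈ s
      · rw [if_neg ha, if_pos hc, if_pos ⟨c, hc, Sym2.mem_mk_right a c⟩]
        refine (card_le_card (t := {vertexPos t c}) fun x hx => ?_).trans_eq (card_singleton _)
        simp only [mem_sdiff, mem_Icc, mem_singleton] at hx ⊢
        omega
      · simp [ha, hc]
  have h₂ : ∑ v ∈ swapVoters n G t L, (swapBallot n t v \ bribedBallot n t s v).card
      = ∑ e ∈ G.edgeFinset, (swapBallot n t (.inl e) \ bribedBallot n t s (.inl e)).card := by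
    simp [swapVoters, sum_disjSum, bribedBallot]
  rw [h₂]
  refine (sum_le_sum h₁).trans ?_
  rw [← card_filter (fun e => ∃ i ∈ s, i ∈ e) G.edgeFinset, mul_comm]
  refine (card_le_card fun e he => ?_).trans (card_biUnion_le_card_mul s
    (fun i => G.edgeFinset.filter fun e => i ∈ e) 3 fun i _ => (card_incident_edges hcubic i).le)
  rw [mem_filter] at he
  obtain ⟨he, i, hi, hie⟩ := he
  exact mem_biUnion.2 ⟨i, hi, mem_filter.2 ⟨he, hie⟩⟩

theorem vertexPos_mem_bribedBallot_edge {s : Finset (Fin n)} (ht : 1 ≤ t)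
    (hs : ∀ u ∈ s, ∀ w ∈ s, ¬ G.Adj u w) {e : Sym2 (Fin n)} (he : e ∈ G.edgeFinset)
    (j : Fin n) :
    vertexPos t j ∈ bribedBallot n t s (.inl e) ↔
      vertexPos t j ∈ swapBallot n t (.inl e) ∧ ¬ (j ∈ s ∧ j ∈ e) := by
  obtain ⟨a, c, hac, rfl⟩ := exists_lt_of_mem_edgeFinset he
  have hadj : G.Adj a c := by simpa using he
  have h₁ := le_vertexPos (t := t) a
  have h₂ := vertexPos_lt_vertexPos (t := t) hac
  have hsucc : vertexPos t j ≠ vertexPos t c + 1 := fun hh =>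
    not_dvd_add_of_dvd (by omega) (by omega) (dvd_vertexPos c) (hh ▸ dvd_vertexPos j)
  have hpred : vertexPos t j ≠ vertexPos t a - 1 := fun hh =>
    not_dvd_sub_of_dvd (by omega) (by omega) (dvd_vertexPos a) (by omega)
      (hh ▸ dvd_vertexPos j)
  have hja : j = a ↔ vertexPos t j = vertexPos t a := vertexPos_injective.eq_iff.symm
  have hjc : j = c ↔ vertexPos t j = vertexPos t c := vertexPos_injective.eq_iff.symm
  rw [bribedBallot_edge s hac, swapBallot_edge hac, Sym2.mem_iff]
  by_cases ha : a ∈ s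
  · have hc : c ∉ s := fun hc => hs a ha c hc hadj
    have hj : (j ∈ s ∧ (j = a ∨ j = c)) ↔ j = a := by
      constructor
      · rintro ⟨hjs, rfl | rfl⟩
        · rfl
        · exact absurd hjs hc
      · rintro rfl
        exact ⟨ha, .inl rfl⟩
    rw [if_pos ha, hj, hja, mem_Icc, mem_Icc]
    omega
  · rw [if_neg ha]
    by_cases hc : c ∈ s
    · have hj : (j ∈ s ∧ (j = a ∨ j = c)) ↔ j = c := by
        constructor
        · rintro ⟨hjs, rfl | rfl⟩
          · exact absurd hjs ha
          · rfl
        · rintro rfl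
          exact ⟨hc, .inr rfl⟩
      rw [if_pos hc, hj, hjc, mem_Icc, mem_Icc]
      omega
    · have hj : ¬ (j ∈ s ∧ (j = a ∨ j = c)) := by
        rintro ⟨hjs, rfl | rfl⟩
        · exact ha hjs
        · exact hc hjs
      rw [if_neg hc]
      simp only [hj, not_false_eq_true, and_true]

theorem swapScore_bribed_vertexPos_of_notMem {s : Finset (Fin n)} (ht : 1 ≤ t)
    (hL : L = G.edgeFinset.card) (hs : ∀ u ∈ s, ∀ w ∈ s, ¬ G.Adj u w) {j : Fin n}
    (hj : j ∉ s) : swapScore n G t L (bribedBallot n t s) (vertexPos t j) = L := by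
  refine Eq.trans (congrArg card (filter_congr fun v hv => ?_)) (swapScore_vertexPos ht hL j)
  rcases v with e | v
  · rw [vertexPos_mem_bribedBallot_edge ht hs (mem_swapVoters_edge.1 hv)]
    simp [hj]
  · rfl

theorem swapScore_bribed_vertexPos_of_mem [DecidableRel G.Adj]
    (hcubic : ∀ v : Fin n, G.degree v = 3) {s : Finset (Fin n)} (ht : 1 ≤ t)
    (hL : L = G.edgeFinset.card) (hs : ∀ u ∈ s, ∀ w ∈ s, ¬ G.Adj u w) {j : Fin n}
    (hj : j ∈ s) : swapScore n G t L (bribedBallot n t s) (vertexPos t j) ≤ L - 3 := by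
  have h₁ := swapScore_vertexPos (G := G) ht hL j
  unfold swapScore at h₁ ⊢
  set I := (G.edgeFinset.filter fun e => j ∈ e).map
    (⟨Sum.inl, Sum.inl_injective⟩ : Sym2 (Fin n) ↪ SwapVoter n) with hI
  have hIcard : I.card = 3 := by rw [hI, card_map, card_incident_edges hcubic]
  have hsub : I ⊆ (swapVoters n G t L).filter fun v => vertexPos t j ∈ swapBallot n t v := by
    intro v hv
    obtain ⟨e, he, rfl⟩ := mem_map.1 hv
    rw [mem_filter] at he
    refine mem_filter.2 ⟨mem_swapVoters_edge.2 he.1, ?_⟩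
    obtain ⟨a, c, hac, rfl⟩ := exists_lt_of_mem_edgeFinset he.1
    have h₂ := vertexPos_lt_vertexPos (t := t) hac
    rw [Function.Embedding.coeFn_mk, swapBallot_edge hac, mem_Icc]
    rcases Sym2.mem_iff.1 he.2 with rfl | rfl <;> omega
  refine (card_le_card fun v hv => ?_).trans
    (card_sdiff_of_subset hsub |>.trans (by rw [h₁, hIcard])).le
  rw [mem_filter] at hv
  obtain ⟨hv, hmem⟩ := hv
  rw [mem_sdiff, mem_filter]
  rcases v with e | v
  · have he := mem_swapVoters_edge.1 hv
    rw [vertexPos_mem_bribedBallot_edge ht hs he] at hmem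
    refine ⟨⟨hv, hmem.1⟩, fun hvI => hmem.2 ⟨hj, ?_⟩⟩
    obtain ⟨e', he', heq⟩ := mem_map.1 hvI
    obtain rfl : e' = e := Sum.inl_injective heq
    exact (mem_filter.1 he').2
  · refine ⟨⟨hv, hmem⟩, fun hvI => ?_⟩
    obtain ⟨e', _, heq⟩ := mem_map.1 hvI
    simp at heq

theorem swapScore_bribed_dummy (s : Finset (Fin n)) (ht : 1 ≤ t) {c : ℕ}
    (hc : c ∈ Ico (n * (t + 1) + t + 1) (t * (n + 2) + n + 1)) :
    swapScore n G t L (bribedBallot n t s) c = 0 := by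
  rw [swapScore, card_eq_zero, filter_eq_empty_iff]
  intro v hv hmem
  rw [mem_Ico] at hc
  have hbounds := swapBallot_mem_bounds hv
  rcases v with e | ⟨i, m⟩ | q | ⟨g, m⟩
  · obtain ⟨a, d, had, rfl⟩ := exists_lt_of_mem_edgeFinset (mem_swapVoters_edge.1 hv)
    have h₁ := vertexPos_le (t := t) d
    rw [bribedBallot_edge s had] at hmem
    split_ifs at hmem
    all_goals
      rw [mem_Icc] at hmem
      omega
  · have := (hbounds (by simp)).2 c hmem
    omega
  · simp only [bribedBallot, swapBallot, mem_singleton] at hmem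
    omega
  · have := (hbounds (by simp)).2 c hmem
    omega

theorem le_swapScore_bribed_preferred (s : Finset (Fin n)) :
    L - 3 ≤ swapScore n G t L (bribedBallot n t s) (t * (n + 2) + n + 1) := by
  unfold swapScore swapVoters
  rw [card_filter_disjSum_eq, card_filter_disjSum_eq, card_filter_disjSum_eq]
  simp only [bribedBallot, swapBallot, mem_singleton, filter_true, card_range]
  omega

theorem exists_committee_of_independent [DecidableRel G.Adj]
    (hcubic : ∀ v : Fin n, G.degree v = 3) {s : Finset (Fin n)} (ht : 1 ≤ t)
    (hL : L = G.edgeFinset.card) (hs : ∀ u ∈ s, ∀ w ∈ s, ¬ G.Adj u w) :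
    ∃ W ⊆ Icc 1 (t * (n + 2) + n + 1),
      W.card = t * (n + 1) + (n - s.card) + 1 ∧ t * (n + 2) + n + 1 ∈ W ∧
      ∀ W' ⊆ Icc 1 (t * (n + 2) + n + 1), W'.card = W.card →
        ∑ c ∈ W', swapScore n G t L (bribedBallot n t s) c ≤
          ∑ c ∈ W, swapScore n G t L (bribedBallot n t s) c := by
  have hP := preferredPos_eq (n := n) (t := t)
  set P := t * (n + 2) + n + 1 with hPdef
  set D := Ico (n * (t + 1) + t + 1) P ∪ s.image (vertexPos t) with hD
  have hvertex : ∀ i : Fin n, 1 ≤ vertexPos t i ∧ vertexPos t i ≤ n * (t + 1) := fun i => by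
    have := le_vertexPos (t := t) i
    exact ⟨by omega, vertexPos_le i⟩
  have hDsub : D ⊆ Icc 1 P := by
    refine union_subset (fun c hc => ?_) fun c hc => ?_
    · rw [mem_Ico] at hc
      rw [mem_Icc]
      omega
    · obtain ⟨i, _, rfl⟩ := mem_image.1 hc
      have := hvertex i
      rw [mem_Icc]
      omega
  have hDcard : D.card = t + s.card := by
    rw [hD, card_union_of_disjoint, Nat.card_Ico,
      card_image_of_injective _ vertexPos_injective]
    · omega
    · rw [disjoint_left]
      intro c hc hc'
      obtain ⟨i, _, rfl⟩ := mem_image.1 hc'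
      have := hvertex i
      rw [mem_Ico] at hc
      omega
  refine ⟨Icc 1 P \ D, sdiff_subset, ?_, ?_, fun W' hW' hcard => ?_⟩
  · have h₁ : s.card ≤ n := by simpa using card_le_univ s
    have h₂ : n * (t + 1) + t = t * (n + 1) + n := by ring
    rw [card_sdiff_of_subset hDsub, Nat.card_Icc, hDcard]
    omega
  · rw [mem_sdiff, mem_Icc, hD, mem_union, mem_Ico, mem_image]
    refine ⟨by omega, ?_⟩
    rintro (hh | ⟨i, _, hi⟩)
    · omega
    · have := hvertex i
      omega
  · refine sum_le_sum_of_threshold (θ := L - 3) (fun c hc => ?_) (fun c hc hcW => ?_) hW' hcard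
    · rw [mem_sdiff, mem_Icc, hD, mem_union, mem_Ico, mem_image] at hc
      obtain ⟨⟨hc₁, hcP⟩, hcD⟩ := hc
      push Not at hcD
      rcases hcP.eq_or_lt with rfl | hlt
      · exact le_swapScore_bribed_preferred s
      · have hc₂ : c ≤ n * (t + 1) + t := by
          by_contra! hgt
          have := hcD.1 (by omega)
          omega
        rcases axis_cases hc₁ hc₂ with ⟨i, rfl⟩ | ⟨g, hg, hcg⟩
        · rw [swapScore_bribed_vertexPos_of_notMem ht hL hs fun hi => hcD.2 i hi rfl]
          omega
        · have := le_swapScore_filler (G := G) (L := L) (b := bribedBallot n t s)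
            (fun _ => rfl) hg hcg
          omega
    · have hcD : c ∈ D := by
        by_contra hcD
        exact hcW (mem_sdiff.2 ⟨hc, hcD⟩)
      rcases mem_union.1 hcD with hdummy | himg
      · rw [swapScore_bribed_dummy s ht hdummy]
        exact Nat.zero_le _
      · obtain ⟨i, hi, rfl⟩ := mem_image.1 himg
        exact swapScore_bribed_vertexPos_of_mem hcubic ht hL hs hi

end Bribery

/-- NP-hardness construction for `AV-SwapApprovals-CI-Bribery`: for the election built from
a cubic graph `G` and an integer `h` (with `t = 3h + 1`, `L = |E(G)|`, committee size
`k = t(n+1) + (n−h) + 1`, preferred candidate `p` at position `t(n+2)+n+1`, and candidate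
set `[1, t(n+2)+n+1]`), there is a set of at most `3h` approval swaps after which the
election is still CI and `p` belongs to some AV winning committee of size `k`, iff `G` has
an independent set of size `h`. -/
theorem swapApprovals_CI_hardness (n : ℕ) (hn : 1 ≤ n)
    (G : SimpleGraph (Fin n)) [DecidableRel G.Adj] [Fintype G.edgeSet]
    (hcubic : ∀ v : Fin n, G.degree v = 3)
    (h : ℕ) (hhn : h ≤ n) (t L : ℕ) (ht : t = 3 * h + 1) (hL : L = G.edgeFinset.card) :
    (∃ ballot' : SwapVoter n → Finset ℕ,
        (∀ v ∈ swapVoters n G t L,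
          (ballot' v).card = (swapBallot n t v).card ∧
          ballot' v ⊆ Finset.Icc 1 (t * (n + 2) + n + 1) ∧
          IsAxisInterval (ballot' v)) ∧
        (∑ v ∈ swapVoters n G t L, (swapBallot n t v \ ballot' v).card) ≤ 3 * h ∧
        (∃ W ⊆ Finset.Icc 1 (t * (n + 2) + n + 1),
          W.card = t * (n + 1) + (n - h) + 1 ∧ t * (n + 2) + n + 1 ∈ W ∧
          ∀ W' ⊆ Finset.Icc 1 (t * (n + 2) + n + 1),
            W'.card = t * (n + 1) + (n - h) + 1 →
            ∑ c ∈ W', ((swapVoters n G t L).filter fun v => c ∈ ballot' v).card ≤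
              ∑ c ∈ W, ((swapVoters n G t L).filter fun v => c ∈ ballot' v).card))
      ↔ ∃ s : Finset (Fin n), s.card = h ∧ ∀ u ∈ s, ∀ w ∈ s, ¬ G.Adj u w := by
  constructor
  · rintro ⟨b', hvalid, hcost, W, hW, hWcard, hpW, hopt⟩
    exact exists_independent_of_bribery hn hcubic hhn ht hL hvalid hcost hW hWcard hpW
      fun W' hW' hcard => hopt W' hW' (hcard.trans hWcard)
  · rintro ⟨s, rfl, hs⟩
    obtain ⟨W, hW, hWcard, hpW, hopt⟩ :=
      exists_committee_of_independent hcubic (by omega : 1 ≤ t) hL hs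
    exact ⟨bribedBallot n t s, fun v hv => bribedBallot_valid s (by omega) hv,
      bribery_cost_le hcubic s, W, hW, hWcard, hpW,
      fun W' hW' hcard => hopt W' hW' (hcard.trans hWcard.symm)⟩
end
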